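/- arXiv:2506.17745 — 7 statements merged into one kernel-verified Lean document; each statement's English description precedes it below -/
import Mathlib

section
/- Let μ and ν be Borel probability measures supported on the closed unit ball {|x| ≤ 1} of ℝ^d. Then there is an absolute constant c > 0 such that W(μ,ν) ≤ c · (sup_{|θ|=1} W(μ_θ, ν_θ))^β, where β = 2/(2+d). -/
open MeasureTheory
open scoped RealInnerProductSpace ENNReal NNReal

noncomputable section


/-- The Kantorovich (Wasserstein-1) transport distance `W(μ,ν)`:
the infimum of `∬ ‖x - y‖ dπ(x,y)` over all couplings `π` of `μ` and `ν`. -/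
def kantorovichW {X : Type*} [NormedAddCommGroup X] [MeasurableSpace X]
    (μ ν : Measure X) : ℝ :=
  (⨅ π ∈ {π : Measure (X × X) | π.map Prod.fst = μ ∧ π.map Prod.snd = ν},
    ∫⁻ z, (‖z.1 - z.2‖₊ : ℝ≥0∞) ∂π).toReal



lemma dual_key {K : Type*} [MetricSpace K] [CompactSpace K] [MeasurableSpace K]
    [BorelSpace K] (μ ν : Measure K) [IsProbabilityMeasure μ] [IsProbabilityMeasure ν] (D : ℝ)
    (h : ∀ u : K → ℝ, LipschitzWith 1 u → ∫ x, u x ∂μ - ∫ x, u x ∂ν ≤ D)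
    (φ ψ : C(K, ℝ)) (l : ℝ) (hl : 0 ≤ l) (B : ℝ)
    (hB : ∀ x y, -B ≤ φ x + ψ y + l * dist x y) :
    -B ≤ ∫ x, φ x ∂μ + ∫ x, ψ x ∂ν + l * D := by
  have hne : Nonempty K := by
    by_contra hc
    rw [not_nonempty_iff] at hc
    exact IsProbabilityMeasure.ne_zero μ (Measure.eq_zero_of_isEmpty μ)
  let u : K → ℝ := fun y => ⨅ x, (φ x + l * dist x y)
  have hbdd : ∀ y, BddBelow (Set.range fun x => φ x + l * dist x y) := by
    intro y
    refine ⟨-B - ψ y, ?_⟩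
    rintro _ ⟨x, rfl⟩
    have := hB x y
    linarith
  have hu1 : ∀ y, u y ≤ φ y := by
    intro y
    have := ciInf_le (hbdd y) y
    simpa using this
  have hu2 : ∀ y, -ψ y - B ≤ u y := by
    intro y
    refine le_ciInf fun x => ?_
    have := hB x y
    linarith
  have hul : ∀ a b, u a ≤ u b + l * dist a b := by
    intro a b
    rw [← sub_le_iff_le_add]
    refine le_ciInf fun x => ?_
    have h1 := ciInf_le (hbdd a) x
    have h2 := dist_triangle x b a
    rw [dist_comm b a] at h2
    have h3 := mul_le_mul_of_nonneg_left h2 hl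
    change (⨅ x, (φ x + l * dist x a)) - _ ≤ _
    linarith
  have huL : LipschitzWith ⟨l, hl⟩ u := LipschitzWith.of_le_add_mul _ hul
  have hint : ∀ (f : K → ℝ) (hf : Continuous f) (m : Measure K) [IsProbabilityMeasure m],
      Integrable f m := fun f hf m _ =>
    hf.integrable_of_hasCompactSupport (HasCompactSupport.of_compactSpace _)
  have huc := huL.continuous
  have h1 : ∫ x, u x ∂μ ≤ ∫ x, φ x ∂μ :=
    integral_mono (hint _ huc _) (hint _ φ.continuous _) hu1
  have h2 : ∫ x, (-ψ x - B) ∂ν ≤ ∫ x, u x ∂ν :=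
    integral_mono (hint _ (by fun_prop) _) (hint _ huc _) hu2
  rw [integral_sub (hint _ (by fun_prop) _) (integrable_const _), integral_neg] at h2
  simp only [integral_const, probReal_univ, one_smul] at h2
  have h3 : -(l * D) ≤ ∫ x, u x ∂μ - ∫ x, u x ∂ν := by
    rcases hl.eq_or_lt with h0 | h0
    · subst h0
      obtain ⟨a⟩ := hne
      have : ∀ x, u x = u a := by
        intro x
        have := hul x a
        have := hul a x
        simp at *
        linarith
      simp [this]
    · have := h (fun x => -(l⁻¹ * u x)) (by
        refine LipschitzWith.of_le_add_mul _ fun a b => ?_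
        have := mul_le_mul_of_nonneg_left (hul b a) (inv_nonneg.2 hl)
        rw [mul_add, ← mul_assoc, inv_mul_cancel₀ h0.ne', dist_comm] at this
        simp
        linarith)
      rw [integral_neg, integral_neg, integral_const_mul, integral_const_mul] at this
      have h4 := mul_le_mul_of_nonneg_left this hl
      have h5 : l * (-(l⁻¹ * ∫ x, u x ∂μ) - -(l⁻¹ * ∫ x, u x ∂ν))
        = - (∫ x, u x ∂μ - ∫ x, u x ∂ν) := by
        field_simp
        ring
      linarith
  linarith

lemma dual_compact {K : Type*} [MetricSpace K] [CompactSpace K] [SecondCountableTopology K]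
    [MeasurableSpace K]
    [BorelSpace K] (μ ν : Measure K) [IsProbabilityMeasure μ] [IsProbabilityMeasure ν] (D : ℝ)
    (h : ∀ u : K → ℝ, LipschitzWith 1 u → ∫ x, u x ∂μ - ∫ x, u x ∂ν ≤ D) :
    ∃ π : Measure (K × K), IsFiniteMeasure π ∧ π.map Prod.fst = μ ∧ π.map Prod.snd = ν ∧
      ∫ z, dist z.1 z.2 ∂π ≤ D := by
  classical
  let S : CompactlySupportedContinuousMap (K × K) ℝ → Set ℝ := fun g =>
    {r | ∃ (φ ψ : C(K, ℝ)) (l : ℝ), 0 ≤ l ∧ (∀ x y, g (x, y) ≤ φ x + ψ y + l * dist x y) ∧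
      r = ∫ x, φ x ∂μ + ∫ x, ψ x ∂ν + l * D}
  let N : CompactlySupportedContinuousMap (K × K) ℝ → ℝ := fun g => sInf (S g)
  have hbound : ∀ g : CompactlySupportedContinuousMap (K × K) ℝ, ∃ B : ℝ, ∀ z, |g z| ≤ B := by
    intro g
    obtain ⟨B, hB⟩ := (isCompact_univ (X := K × K)).exists_bound_of_continuousOn
      g.continuous.continuousOn
    exact ⟨B, fun z => hB z trivial⟩
  have hbdd : ∀ g, BddBelow (S g) := by
    intro g
    obtain ⟨B, hB⟩ := hbound g
    refine ⟨-B, ?_⟩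
    rintro _ ⟨φ, ψ, l, hl, hg, rfl⟩
    exact dual_key μ ν D h φ ψ l hl B fun x y => (neg_le_of_abs_le (hB (x, y))).trans (hg x y)
  have hne : ∀ g, (S g).Nonempty := by
    intro g
    obtain ⟨B, hB⟩ := hbound g
    refine ⟨_, ContinuousMap.const K B, 0, 0, le_rfl, fun x y => ?_, rfl⟩
    simpa using le_of_abs_le (hB (x, y))
  have hint : ∀ (f : C(K, ℝ)) (m : Measure K) [IsProbabilityMeasure m],
      Integrable f m := fun f m _ =>
    f.continuous.integrable_of_hasCompactSupport (HasCompactSupport.of_compactSpace _)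
  have hSmul : ∀ c : ℝ, 0 < c → ∀ g r, r ∈ S g → c * r ∈ S (c • g) := by
    rintro c hc g _ ⟨φ, ψ, l, hl, hg, rfl⟩
    refine ⟨c • φ, c • ψ, c * l, by positivity, fun x y => ?_, ?_⟩
    · have := mul_le_mul_of_nonneg_left (hg x y) hc.le
      simp
      linarith
    · simp [integral_const_mul]
      ring
  have hNle : ∀ c : ℝ, 0 < c → ∀ g, N (c • g) ≤ c * N g := by
    intro c hc g
    rw [← div_le_iff₀' hc]
    refine le_csInf (hne g) fun r hr => ?_
    rw [div_le_iff₀' hc]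
    exact csInf_le (hbdd _) (hSmul c hc g r hr)
  have Nhom : ∀ c : ℝ, 0 < c → ∀ g, N (c • g) = c * N g := by
    intro c hc g
    refine le_antisymm (hNle c hc g) ?_
    have := hNle c⁻¹ (inv_pos.2 hc) (c • g)
    rw [smul_smul, inv_mul_cancel₀ hc.ne', one_smul, inv_mul_eq_div, le_div_iff₀' hc] at this
    exact this
  have Nadd : ∀ f g, N (f + g) ≤ N f + N g := by
    intro f g
    rw [← sub_le_iff_le_add]
    refine le_csInf (hne f) fun r hr => ?_
    rw [sub_le_iff_le_add, ← sub_le_iff_le_add']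
    refine le_csInf (hne g) fun s hs => ?_
    rw [sub_le_iff_le_add']
    refine csInf_le (hbdd _) ?_
    obtain ⟨φ, ψ, l, hl, hg, rfl⟩ := hr
    obtain ⟨φ', ψ', l', hl', hg', rfl⟩ := hs
    refine ⟨φ + φ', ψ + ψ', l + l', by positivity, fun x y => ?_, ?_⟩
    · have := hg x y
      have := hg' x y
      simp
      linarith
    · simp only [ContinuousMap.add_apply]
      rw [integral_add (hint _ _) (hint _ _), integral_add (hint _ _) (hint _ _)]
      ring
  have hle : ∀ g (φ ψ : C(K, ℝ)) (l : ℝ), 0 ≤ l →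
      (∀ x y, g (x, y) ≤ φ x + ψ y + l * dist x y) →
      N g ≤ ∫ x, φ x ∂μ + ∫ x, ψ x ∂ν + l * D := fun g φ ψ l hl hg =>
    csInf_le (hbdd g) ⟨φ, ψ, l, hl, hg, rfl⟩
  obtain ⟨L, -, hL⟩ := exists_extension_of_le_sublinear
    (⊥ : CompactlySupportedContinuousMap (K × K) ℝ →ₗ.[ℝ] ℝ) N Nhom Nadd (by
      rintro ⟨x, hx⟩
      have hx0 : x = 0 := (Submodule.mem_bot ℝ).1 hx
      subst hx0
      have h0 : (⊥ : CompactlySupportedContinuousMap (K × K) ℝ →ₗ.[ℝ] ℝ) ⟨0, hx⟩ = 0 :=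
        LinearPMap.map_zero _
      rw [h0]
      refine le_csInf (hne 0) ?_
      rintro _ ⟨φ, ψ, l, hl, hg, rfl⟩
      have := dual_key μ ν D h φ ψ l hl 0 fun x y => by simpa using hg x y
      simpa using this)
  have hpos : ∀ g, 0 ≤ g → 0 ≤ L g := by
    intro g hg
    have h1 := hL (-g)
    have h2 := hle (-g) 0 0 0 le_rfl (fun x y => by simpa using hg (x, y))
    rw [map_neg] at h1
    simp at h2
    linarith
  let Λ : CompactlySupportedContinuousMap (K × K) ℝ →ₚ[ℝ] ℝ := PositiveLinearMap.mk₀ L hpos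
  let mkc : C(K × K, ℝ) → CompactlySupportedContinuousMap (K × K) ℝ := fun f =>
    { toFun := f
      hasCompactSupport' := HasCompactSupport.of_compactSpace _ }
  have hΛ : ∀ f : C(K × K, ℝ), ∫ z, f z ∂(RealRMK.rieszMeasure Λ) = L (mkc f) := fun f =>
    RealRMK.integral_rieszMeasure Λ (mkc f)
  have hfst : ∀ φ : C(K, ℝ), L (mkc (φ.comp ⟨Prod.fst, continuous_fst⟩)) = ∫ x, φ x ∂μ := by
    intro φ
    apply le_antisymm
    · refine (hL _).trans ?_
      have := hle (mkc (φ.comp ⟨Prod.fst, continuous_fst⟩)) φ 0 0 le_rfl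
        (fun x y => by simp [mkc])
      simpa using this
    · have h1 := hL (-mkc (φ.comp ⟨Prod.fst, continuous_fst⟩))
      have h2 := hle (-mkc (φ.comp ⟨Prod.fst, continuous_fst⟩)) (-φ) 0 0 le_rfl
        (fun x y => by simp [mkc])
      rw [map_neg] at h1
      simp [integral_neg] at h2
      linarith
  have hsnd : ∀ φ : C(K, ℝ), L (mkc (φ.comp ⟨Prod.snd, continuous_snd⟩)) = ∫ x, φ x ∂ν := by
    intro φ
    apply le_antisymm
    · refine (hL _).trans ?_
      have := hle (mkc (φ.comp ⟨Prod.snd, continuous_snd⟩)) 0 φ 0 le_rfl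
        (fun x y => by simp [mkc])
      simpa using this
    · have h1 := hL (-mkc (φ.comp ⟨Prod.snd, continuous_snd⟩))
      have h2 := hle (-mkc (φ.comp ⟨Prod.snd, continuous_snd⟩)) 0 (-φ) 0 le_rfl
        (fun x y => by simp [mkc])
      rw [map_neg] at h1
      simp [integral_neg] at h2
      linarith
  have hfin : IsFiniteMeasure (RealRMK.rieszMeasure Λ) := by infer_instance
  refine ⟨RealRMK.rieszMeasure Λ, hfin, ?_, ?_, ?_⟩
  · have : IsFiniteMeasure ((RealRMK.rieszMeasure Λ).map Prod.fst) :=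
      Measure.isFiniteMeasure_map _ _
    apply ext_of_forall_integral_eq_of_IsFiniteMeasure
    intro f
    rw [integral_map measurable_fst.aemeasurable f.continuous.aestronglyMeasurable]
    refine Eq.trans ?_ (hfst f.toContinuousMap)
    exact hΛ (f.toContinuousMap.comp ⟨Prod.fst, continuous_fst⟩)
  · have : IsFiniteMeasure ((RealRMK.rieszMeasure Λ).map Prod.snd) :=
      Measure.isFiniteMeasure_map _ _
    apply ext_of_forall_integral_eq_of_IsFiniteMeasure
    intro f
    rw [integral_map measurable_snd.aemeasurable f.continuous.aestronglyMeasurable]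
    refine Eq.trans ?_ (hsnd f.toContinuousMap)
    exact hΛ (f.toContinuousMap.comp ⟨Prod.snd, continuous_snd⟩)
  · have h1 := hΛ ⟨fun z => dist z.1 z.2, by fun_prop⟩
    refine h1.le.trans ((hL _).trans ?_)
    have := hle (mkc ⟨fun z => dist z.1 z.2, by fun_prop⟩) 0 0 1 zero_le_one
      (fun x y => by simp [mkc])
    simpa using this

lemma W_le_of_dual {d : ℕ} (μ ν : Measure (EuclideanSpace ℝ (Fin d)))
    [IsProbabilityMeasure μ] [IsProbabilityMeasure ν]
    (hμ : ∀ᵐ x ∂μ, x ∈ Metric.closedBall (0 : EuclideanSpace ℝ (Fin d)) 1)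
    (hν : ∀ᵐ x ∂ν, x ∈ Metric.closedBall (0 : EuclideanSpace ℝ (Fin d)) 1) (D : ℝ)
    (h : ∀ u : EuclideanSpace ℝ (Fin d) → ℝ, LipschitzWith 1 u →
      ∫ x, u x ∂μ - ∫ x, u x ∂ν ≤ D) :
    kantorovichW μ ν ≤ D := by
  let s := Metric.closedBall (0 : EuclideanSpace ℝ (Fin d)) 1
  have hs : MeasurableSet s := measurableSet_closedBall
  have : CompactSpace s := isCompact_iff_compactSpace.1 (isCompact_closedBall _ _)
  have hmap : ∀ m : Measure (EuclideanSpace ℝ (Fin d)), (∀ᵐ x ∂m, x ∈ s) →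
      (m.comap (Subtype.val : s → _)).map Subtype.val = m := by
    intro m hm
    rw [map_comap_subtype_coe hs, Measure.restrict_eq_self_of_ae_mem hm]
  have hprob : ∀ m : Measure (EuclideanSpace ℝ (Fin d)), IsProbabilityMeasure m →
      (∀ᵐ x ∂m, x ∈ s) → IsProbabilityMeasure (m.comap (Subtype.val : s → _)) := by
    intro m hp hm
    constructor
    have h1 := congrArg (fun m' => m' Set.univ) (hmap m hm)
    simp only [measure_univ] at h1
    rw [Measure.map_apply measurable_subtype_coe MeasurableSet.univ] at h1
    simpa using h1
  have p1 := hprob μ inferInstance hμ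
  have p2 := hprob ν inferInstance hν
  obtain ⟨π, hπ, h1, h2, h3⟩ := dual_compact (μ.comap (Subtype.val : s → _))
    (ν.comap (Subtype.val : s → _)) D (by
      intro u hu
      obtain ⟨g, hg, hge⟩ := LipschitzOnWith.extend_real (K := 1)
        (f := Function.extend (Subtype.val : s → _) u 0) (s := s) (by
          refine LipschitzOnWith.of_dist_le_mul ?_
          intro x hx y hy
          have e1 := Subtype.val_injective.extend_apply u 0 (⟨x, hx⟩ : s)
          have e2 := Subtype.val_injective.extend_apply u 0 (⟨y, hy⟩ : s)
          simp only at e1 e2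
          rw [e1, e2]
          exact hu.dist_le_mul ⟨x, hx⟩ ⟨y, hy⟩)
      have hug : ∀ x : s, u x = g x := by
        intro x
        rw [← hge x.2, Subtype.val_injective.extend_apply]
      have key : ∀ m : Measure (EuclideanSpace ℝ (Fin d)), (∀ᵐ x ∂m, x ∈ s) →
          ∫ x, u x ∂(m.comap (Subtype.val : s → _)) = ∫ x, g x ∂m := by
        intro m hm
        conv_rhs => rw [← hmap m hm]
        rw [integral_map measurable_subtype_coe.aemeasurable
          hg.continuous.aestronglyMeasurable]
        simp_rw [hug]
      rw [key μ hμ, key ν hν]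
      exact h g hg)
  have hD : 0 ≤ D := le_trans (integral_nonneg fun z => dist_nonneg) h3
  refine ENNReal.toReal_le_of_le_ofReal hD ?_
  refine (iInf₂_le (π.map (Prod.map Subtype.val Subtype.val)) ⟨?_, ?_⟩).trans ?_
  rotate_left
  · rw [Measure.map_map measurable_fst (by fun_prop)]
    conv_rhs => rw [← hmap μ hμ, ← h1, Measure.map_map measurable_subtype_coe measurable_fst]
    rfl
  · rw [Measure.map_map measurable_snd (by fun_prop)]
    conv_rhs => rw [← hmap ν hν, ← h2, Measure.map_map measurable_subtype_coe measurable_snd]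
    rfl
  · rw [lintegral_map (by fun_prop) (by fun_prop)]
    refine le_trans (le_of_eq ?_) (ENNReal.ofReal_le_ofReal h3)
    rw [ofReal_integral_eq_lintegral_ofReal]
    · refine lintegral_congr fun z => ?_
      rw [Subtype.dist_eq, dist_eq_norm, ofReal_norm]
      rfl
    · exact Continuous.integrable_of_hasCompactSupport (by fun_prop)
        (HasCompactSupport.of_compactSpace _)
    · exact Filter.Eventually.of_forall fun z => dist_nonneg

lemma inf_le_two {X : Type*} [NormedAddCommGroup X] [MeasurableSpace X] [BorelSpace X]
    [SecondCountableTopology X]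
    (μ ν : Measure X) [IsProbabilityMeasure μ] [IsProbabilityMeasure ν]
    (hμ : ∀ᵐ x ∂μ, ‖x‖ ≤ 1) (hν : ∀ᵐ x ∂ν, ‖x‖ ≤ 1) :
    (⨅ π ∈ {π : Measure (X × X) | π.map Prod.fst = μ ∧ π.map Prod.snd = ν},
    ∫⁻ z, (‖z.1 - z.2‖₊ : ℝ≥0∞) ∂π) ≤ 2 := by
  refine (iInf₂_le (μ.prod ν) ⟨by simp, by simp⟩).trans ?_
  have h1 : ∀ᵐ z ∂(μ.prod ν), ‖z.1‖ ≤ 1 := Measure.quasiMeasurePreserving_fst.ae hμ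
  have h2 : ∀ᵐ z ∂(μ.prod ν), ‖z.2‖ ≤ 1 := Measure.quasiMeasurePreserving_snd.ae hν
  calc ∫⁻ z, (‖z.1 - z.2‖₊ : ℝ≥0∞) ∂(μ.prod ν) ≤ ∫⁻ z, 2 ∂(μ.prod ν) := by
        refine lintegral_mono_ae ?_
        filter_upwards [h1, h2] with z a b
        have : ‖z.1 - z.2‖₊ ≤ 2 := by
          rw [← NNReal.coe_le_coe]
          simp only [coe_nnnorm]
          have := norm_sub_le z.1 z.2
          push_cast
          linarith
        exact_mod_cast this
    _ = 2 := by simp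

lemma charFun_diff_le (α β : Measure ℝ) [IsProbabilityMeasure α] [IsProbabilityMeasure β]
    (hα : ∀ᵐ x ∂α, ‖x‖ ≤ 1) (hβ : ∀ᵐ x ∂β, ‖x‖ ≤ 1) (s : ℝ) :
    ‖charFun α s - charFun β s‖ ≤ |s| * kantorovichW α β := by
  rcases eq_or_ne s 0 with h0 | h0
  · subst h0
    simp
  have hs : 0 < |s| := abs_pos.2 h0
  rw [← div_le_iff₀' hs]
  have hfin := ne_top_of_le_ne_top (by simp) (inf_le_two α β hα hβ)
  refine (ENNReal.ofReal_le_iff_le_toReal hfin).1 ?_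
  refine le_iInf₂ ?_
  rintro π ⟨h1, h2⟩
  have hπ : IsProbabilityMeasure π := by
    constructor
    have := congrArg (fun m => m Set.univ) h1
    simp only [measure_univ] at this
    rw [Measure.map_apply measurable_fst MeasurableSet.univ] at this
    simpa using this
  rw [ENNReal.ofReal_div_of_pos hs]
  refine ENNReal.div_le_of_le_mul' ?_
  have hI : ∀ f : ℝ × ℝ → ℝ, Measurable f → Integrable (fun z => Complex.exp (s * f z * Complex.I)) π := by
    intro f hf
    refine Integrable.of_bound (C := 1) (by fun_prop) ?_
    refine Filter.Eventually.of_forall fun z => ?_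
    have := Complex.norm_exp_ofReal_mul_I (s * f z)
    push_cast at this
    exact this.le
  have e : charFun α s - charFun β s = ∫ z, (Complex.exp (s * z.1 * Complex.I)
      - Complex.exp (s * z.2 * Complex.I)) ∂π := by
    rw [integral_sub (hI _ measurable_fst) (hI _ measurable_snd), charFun_apply_real,
      charFun_apply_real, ← h1, ← h2, integral_map (by fun_prop) (by fun_prop),
      integral_map (by fun_prop) (by fun_prop)]
  rw [e, ofReal_norm]
  refine (enorm_integral_le_lintegral_enorm _).trans ?_
  rw [← lintegral_const_mul _ (by fun_prop)]
  refine lintegral_mono fun z => ?_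
  change ‖_‖ₑ ≤ ENNReal.ofReal |s| * ‖z.1 - z.2‖ₑ
  rw [← ofReal_norm, ← ofReal_norm, ← ENNReal.ofReal_mul (abs_nonneg s)]
  refine ENNReal.ofReal_le_ofReal ?_
  have e2 : Complex.exp (s * z.1 * Complex.I) - Complex.exp (s * z.2 * Complex.I)
      = Complex.exp ((s * z.2 : ℝ) * Complex.I) *
        (Complex.exp (Complex.I * (s * (z.1 - z.2) : ℝ)) - 1) := by
    rw [mul_sub, ← Complex.exp_add, mul_one]
    push_cast
    congr 2
    ring
  rw [e2, norm_mul, Complex.norm_exp_ofReal_mul_I, one_mul]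
  refine (Real.norm_exp_I_mul_ofReal_sub_one_le).trans ?_
  rw [norm_mul, Real.norm_eq_abs]

lemma charFun_diff_le' {d : ℕ} (μ ν : Measure (EuclideanSpace ℝ (Fin d)))
    [IsProbabilityMeasure μ] [IsProbabilityMeasure ν]
    (hμ : ∀ᵐ x ∂μ, ‖x‖ ≤ 1) (hν : ∀ᵐ x ∂ν, ‖x‖ ≤ 1) (t : EuclideanSpace ℝ (Fin d)) :
    ‖charFun μ t - charFun ν t‖ ≤ ‖t‖ *
      (⨆ θ : Metric.sphere (0 : EuclideanSpace ℝ (Fin d)) 1,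
            kantorovichW (μ.map (fun x => ⟪x, (θ : EuclideanSpace ℝ (Fin d))⟫))
              (ν.map (fun x => ⟪x, (θ : EuclideanSpace ℝ (Fin d))⟫))) := by
  rcases eq_or_ne t 0 with h0 | h0
  · subst h0
    simp
  have hae : ∀ (m : Measure (EuclideanSpace ℝ (Fin d))), (∀ᵐ x ∂m, ‖x‖ ≤ 1) →
      ∀ θ : Metric.sphere (0 : EuclideanSpace ℝ (Fin d)) 1,
      ∀ᵐ x ∂(m.map (fun x => ⟪x, (θ : EuclideanSpace ℝ (Fin d))⟫)), ‖x‖ ≤ 1 := by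
    intro m hm θ
    rw [ae_map_iff (by fun_prop) (measurableSet_le (by fun_prop) (by fun_prop))]
    filter_upwards [hm] with x hx
    refine (norm_inner_le_norm _ _).trans ?_
    rw [mem_sphere_zero_iff_norm.1 θ.2]
    simpa using hx
  have hpr : ∀ (m : Measure (EuclideanSpace ℝ (Fin d))), IsProbabilityMeasure m →
      ∀ θ : Metric.sphere (0 : EuclideanSpace ℝ (Fin d)) 1,
      IsProbabilityMeasure (m.map (fun x => ⟪x, (θ : EuclideanSpace ℝ (Fin d))⟫)) :=
    fun m hm θ => Measure.isProbabilityMeasure_map (by fun_prop)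
  have hbdd : BddAbove (Set.range fun θ : Metric.sphere (0 : EuclideanSpace ℝ (Fin d)) 1 =>
            kantorovichW (μ.map (fun x => ⟪x, (θ : EuclideanSpace ℝ (Fin d))⟫))
              (ν.map (fun x => ⟪x, (θ : EuclideanSpace ℝ (Fin d))⟫))) := by
    refine ⟨2, ?_⟩
    rintro _ ⟨θ, rfl⟩
    have := hpr μ inferInstance θ
    have := hpr ν inferInstance θ
    exact ENNReal.toReal_le_of_le_ofReal (by norm_num)
      ((inf_le_two _ _ (hae μ hμ θ) (hae ν hν θ)).trans (by simp))
  let θ : Metric.sphere (0 : EuclideanSpace ℝ (Fin d)) 1 := ⟨‖t‖⁻¹ • t, by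
    simp [norm_smul, h0]⟩
  have := hpr μ inferInstance θ
  have := hpr ν inferInstance θ
  have key := charFun_diff_le _ _ (hae μ hμ θ) (hae ν hν θ) ‖t‖
  have hc : ∀ m : Measure (EuclideanSpace ℝ (Fin d)),
      charFun (m.map (fun x => ⟪x, (θ : EuclideanSpace ℝ (Fin d))⟫)) ‖t‖ = charFun m t := by
    intro m
    rw [charFun_apply_real, integral_map (by fun_prop) (by fun_prop), charFun_apply]
    congr 1
    ext x
    have : ⟪x, t⟫ = ‖t‖ * ⟪x, (θ : EuclideanSpace ℝ (Fin d))⟫ := by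
      simp only [θ, inner_smul_right]
      field_simp [norm_ne_zero_iff.2 h0]
    rw [this]
    push_cast
    rfl
  rw [hc, hc, abs_norm] at key
  exact key.trans (mul_le_mul_of_nonneg_left (le_ciSup hbdd θ) (norm_nonneg _))

open LineDeriv in
/-- partial derivative of a Schwartz function -/
def pd {d : ℕ} (U : SchwartzMap (EuclideanSpace ℝ (Fin d)) ℂ) (i : Fin d) :
    SchwartzMap (EuclideanSpace ℝ (Fin d)) ℂ := ∂_{EuclideanSpace.single i (1 : ℝ)} U


open FourierTransform LineDeriv in
lemma fourier_pairing {d : ℕ} (μ : Measure (EuclideanSpace ℝ (Fin d)))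
    [IsProbabilityMeasure μ] (V : SchwartzMap (EuclideanSpace ℝ (Fin d)) ℂ) :
    ∫ x, V x ∂μ = ∫ t, charFun μ ((2 * Real.pi) • t) * (𝓕 V) t := by
  have h := VectorFourier.integral_fourierIntegral_smul_eq_flip (μ := μ)
    (ν := (volume : Measure (EuclideanSpace ℝ (Fin d))))
    (L := -innerₗ (EuclideanSpace ℝ (Fin d))) (f := fun _ => (1 : ℂ)) (g := ⇑(𝓕 V : SchwartzMap (EuclideanSpace ℝ (Fin d)) ℂ))
    Real.continuous_fourierChar (by
      simp only [LinearMap.neg_apply, innerₗ_apply_apply]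
      fun_prop) (integrable_const _)
    (𝓕 V : SchwartzMap (EuclideanSpace ℝ (Fin d)) ℂ).integrable
  have e1 : ∀ x, VectorFourier.fourierIntegral Real.fourierChar volume
      (-innerₗ (EuclideanSpace ℝ (Fin d))).flip
      (⇑(𝓕 V : SchwartzMap (EuclideanSpace ℝ (Fin d)) ℂ)) x = V x := by
    intro x
    have : V x = 𝓕⁻ (𝓕 V) x := by simp
    rw [this, SchwartzMap.fourierInv_coe, Real.fourierInv_eq]
    simp [VectorFourier.fourierIntegral, real_inner_comm]
  have e2 : ∀ t, VectorFourier.fourierIntegral Real.fourierChar μ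
      (-innerₗ (EuclideanSpace ℝ (Fin d))) (fun _ => (1 : ℂ)) t =
      charFun μ ((2 * Real.pi) • t) := by
    intro t
    rw [charFun_apply]
    simp only [VectorFourier.fourierIntegral, inner_smul_right]
    congr 1
    ext x
    simp [Circle.smul_def, Real.fourierChar_apply]
  simp only [e1, e2, smul_eq_mul, one_mul] at h
  exact h.symm

lemma cs_schwartz {d : ℕ} (f g : SchwartzMap (EuclideanSpace ℝ (Fin d)) ℂ) :
    ∫ t, ‖f t‖ * ‖g t‖ ≤ √((∫ t, ‖f t‖ ^ 2) * (∫ t, ‖g t‖ ^ 2)) := by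
  have h := integral_mul_norm_le_Lp_mul_Lq (μ := volume) (f := f) (g := g) (p := 2) (q := 2)
    Real.HolderConjugate.two_two (by simpa using f.memLp 2) (by simpa using g.memLp 2)
  refine h.trans (le_of_eq ?_)
  rw [Real.sqrt_mul (integral_nonneg fun _ => by positivity), Real.sqrt_eq_rpow,
    Real.sqrt_eq_rpow]
  norm_num

set_option maxHeartbeats 1000000 in
open FourierTransform LineDeriv in
lemma conv_bound {d : ℕ} (μ ν : Measure (EuclideanSpace ℝ (Fin d)))
    [IsProbabilityMeasure μ] [IsProbabilityMeasure ν] (M : ℝ) (hM0 : 0 ≤ M)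
    (hM : ∀ t, ‖charFun μ t - charFun ν t‖ ≤ ‖t‖ * M)
    (U η : SchwartzMap (EuclideanSpace ℝ (Fin d)) ℂ) (A B : ℝ) (hA : 0 ≤ A)
    (hU : ∀ i, ∫ x, ‖(pd U i) x‖ ^ 2 ≤ A)
    (hη : ∫ x, ‖η x‖ ^ 2 ≤ B) :
    ‖∫ x, SchwartzMap.convolution (ContinuousLinearMap.mul ℂ ℂ) η U x ∂μ
      - ∫ x, SchwartzMap.convolution (ContinuousLinearMap.mul ℂ ℂ) η U x ∂ν‖
      ≤ M * (d * √(A * B)) := by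
  set V := SchwartzMap.convolution (ContinuousLinearMap.mul ℂ ℂ) η U
  have hV : ∀ t, 𝓕 V t = 𝓕 η t * 𝓕 U t := by
    intro t
    rw [SchwartzMap.fourier_convolution]
    simp
  have hD : ∀ i t, ‖𝓕 (pd U i) t‖
      = 2 * Real.pi * |t i| * ‖𝓕 U t‖ := by
    intro i t
    have : (fun x : EuclideanSpace ℝ (Fin d) =>
      inner ℝ x (EuclideanSpace.single i (1 : ℝ))).HasTemperateGrowth := by fun_prop
    rw [pd, SchwartzMap.fourier_lineDerivOp_eq]
    have e : ⟪t, EuclideanSpace.single i (1 : ℝ)⟫ = t i := by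
      rw [EuclideanSpace.inner_single_right]
      simp
    simp [SchwartzMap.smulLeftCLM_apply_apply this, abs_of_pos Real.pi_pos, e]
    ring
  have hint : ∀ m : Measure (EuclideanSpace ℝ (Fin d)), IsProbabilityMeasure m →
      Integrable (fun t => charFun m ((2 * Real.pi) • t) * (𝓕 V) t) := by
    intro m hm
    refine (𝓕 V).integrable.bdd_mul (c := 1) ?_ ?_
    · exact (measurable_charFun.comp (by fun_prop)).aestronglyMeasurable
    · exact Filter.Eventually.of_forall fun t => norm_charFun_le_one _
  rw [fourier_pairing, fourier_pairing, ← integral_sub (hint μ inferInstance) (hint ν inferInstance)]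
  have hI : ∀ i, Integrable (fun t => ‖𝓕 (pd U i) t‖ * ‖𝓕 η t‖) := by
    intro i
    exact ((𝓕 (pd U i)).memLp 2).norm.integrable_mul ((𝓕 η).memLp 2).norm
  calc ‖∫ t, (charFun μ ((2 * Real.pi) • t) * (𝓕 V) t - charFun ν ((2 * Real.pi) • t) * (𝓕 V) t)‖
      ≤ ∫ t, M * ∑ i, ‖𝓕 (pd U i) t‖ * ‖𝓕 η t‖ := by
        refine norm_integral_le_of_norm_le ?_ (Filter.Eventually.of_forall fun t => ?_)
        · exact (integrable_finsetSum _ fun i _ => hI i).const_mul M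
        · rw [← sub_mul, norm_mul, hV, norm_mul]
          have h1 := hM ((2 * Real.pi) • t)
          have h2 : ‖t‖ ≤ ∑ i, |t i| := by
            rw [EuclideanSpace.norm_eq]
            refine Real.sqrt_le_iff.2 ⟨Finset.sum_nonneg fun i _ => abs_nonneg _, ?_⟩
            exact Finset.sum_sq_le_sq_sum_of_nonneg fun i _ => abs_nonneg _
          rw [norm_smul, Real.norm_eq_abs, abs_of_pos (by positivity)] at h1
          simp_rw [hD]
          rw [← Finset.sum_mul, ← Finset.sum_mul, ← Finset.mul_sum]
          calc _ ≤ (2 * Real.pi * (∑ i, |t i|) * M) * (‖𝓕 η t‖ * ‖𝓕 U t‖) := by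
                gcongr
                exact h1.trans (by gcongr)
            _ = _ := by ring
    _ = M * ∑ i, ∫ t, ‖𝓕 (pd U i) t‖ * ‖𝓕 η t‖ := by
        rw [integral_const_mul, integral_finsetSum _ fun i _ => hI i]
    _ ≤ M * ∑ i : Fin d, √(A * B) := by
        gcongr with i
        refine (cs_schwartz _ _).trans ?_
        rw [SchwartzMap.integral_norm_sq_fourier, SchwartzMap.integral_norm_sq_fourier]
        refine Real.sqrt_le_sqrt ?_
        exact mul_le_mul (hU i) hη (integral_nonneg fun _ => by positivity) hA
    _ = _ := by simp

open Convolution in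
lemma smooth_step {d : ℕ} (φ : ContDiffBump (0 : EuclideanSpace ℝ (Fin d)))
    (u : EuclideanSpace ℝ (Fin d) → ℝ) (hu : LipschitzWith 1 u) (R : ℝ)
    (hR : ∀ x, R ≤ ‖x‖ → u x = 0) :
    let U := (φ.normed volume ⋆[ContinuousLinearMap.lsmul ℝ ℝ, volume] u)
    (∀ x, |U x - u x| ≤ φ.rOut) ∧ LipschitzWith 1 U ∧ ContDiff ℝ ((⊤ : ℕ∞) : WithTop ℕ∞) U ∧
      (∀ x, R + φ.rOut ≤ ‖x‖ → U x = 0) := by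
  intro U
  have hex : ∀ x, Integrable (fun t => φ.normed volume t * u (x - t)) := by
    intro x
    refine Continuous.integrable_of_hasCompactSupport ?_ ?_
    · have := φ.continuous_normed (μ := volume)
      have := hu.continuous
      fun_prop
    · exact φ.hasCompactSupport_normed.mul_right
  have hU : ∀ x, U x = ∫ t, φ.normed volume t * u (x - t) := fun x => rfl
  refine ⟨?_, ?_, ?_, ?_⟩
  · intro x
    rw [← Real.dist_eq]
    refine φ.dist_normed_convolution_le hu.continuous.aestronglyMeasurable fun y hy => ?_
    have := hu.dist_le_mul y x
    rw [Metric.mem_ball] at hy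
    simp at this
    linarith
  · refine LipschitzWith.of_le_add_mul _ fun x y => ?_
    rw [hU, hU]
    have h1 : ∫ t, φ.normed volume t * dist x y = dist x y := by
      rw [integral_mul_const, φ.integral_normed, one_mul]
    simp only [NNReal.coe_one, one_mul]
    rw [← h1, ← integral_add (hex y) (φ.integrable_normed.mul_const _)]
    refine integral_mono (hex x) ((hex y).add (φ.integrable_normed.mul_const _)) fun t => ?_
    simp only [Pi.add_apply]
    rw [← mul_add]
    refine mul_le_mul_of_nonneg_left ?_ (φ.nonneg_normed t)
    have := hu.dist_le_mul (x - t) (y - t)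
    rw [dist_sub_right, Real.dist_eq] at this
    have := le_of_abs_le this
    simp at this
    linarith
  · exact (φ.hasCompactSupport_normed (μ := volume)).contDiff_convolution_left _
      (φ.contDiff_normed (μ := volume)) hu.continuous.locallyIntegrable
  · intro x hx
    rw [hU]
    refine integral_eq_zero_of_ae (Filter.Eventually.of_forall fun t => ?_)
    simp only [Pi.zero_apply]
    by_cases ht : ‖t‖ < φ.rOut
    · rw [hR, mul_zero]
      have := norm_sub_norm_le x t
      linarith
    · have : φ.normed volume t = 0 := by
        rw [← Function.notMem_support, φ.support_normed_eq]
        simpa using ht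
      rw [this, zero_mul]

open Convolution in
lemma main_bound {d : ℕ} (μ ν : Measure (EuclideanSpace ℝ (Fin d)))
    [IsProbabilityMeasure μ] [IsProbabilityMeasure ν] (M : ℝ) (hM0 : 0 ≤ M)
    (hM : ∀ t, ‖charFun μ t - charFun ν t‖ ≤ ‖t‖ * M)
    (u : EuclideanSpace ℝ (Fin d) → ℝ) (hu : LipschitzWith 1 u)
    (hR : ∀ x, 2 ≤ ‖x‖ → u x = 0) (a : ℝ) (ha : 0 < a) (ha1 : a ≤ 1) :
    ∫ x, u x ∂μ - ∫ x, u x ∂ν ≤ 4 * a + M * √((24 / a) ^ d) := by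
  let φ : ContDiffBump (0 : EuclideanSpace ℝ (Fin d)) := ⟨a / 2, a, by positivity, by linarith⟩
  let η := φ.normed volume
  let U := (η ⋆[ContinuousLinearMap.lsmul ℝ ℝ, volume] u)
  obtain ⟨hU1, hU2, hU3, hU4⟩ := smooth_step φ u hu 2 hR
  obtain ⟨hV1, hV2, hV3, hV4⟩ := smooth_step φ U hU2 _ hU4
  change ∀ x, |U x - u x| ≤ a at hU1
  change LipschitzWith 1 U at hU2
  change ContDiff ℝ ((⊤ : ℕ∞) : WithTop ℕ∞) U at hU3
  change ∀ x, 2 + a ≤ ‖x‖ → U x = 0 at hU4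
  let V := (η ⋆[ContinuousLinearMap.lsmul ℝ ℝ, volume] U)
  change ∀ x, |V x - U x| ≤ a at hV1
  change LipschitzWith 1 V at hV2
  change ∀ x, 2 + a + a ≤ ‖x‖ → V x = 0 at hV4
  have hUs : HasCompactSupport U := by
    refine HasCompactSupport.intro (isCompact_closedBall (0 : EuclideanSpace ℝ (Fin d)) 3) ?_
    intro x hx
    simp at hx
    exact hU4 x (by linarith)
  have hUcs : HasCompactSupport (fun x => (U x : ℂ)) :=
    hUs.comp_left (g := fun r : ℝ => (r : ℂ)) (by simp)
  have hUcc : ContDiff ℝ ((⊤ : ℕ∞) : WithTop ℕ∞) (fun x => (U x : ℂ)) :=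
    Complex.ofRealCLM.contDiff.comp hU3
  have hηcs : HasCompactSupport (fun x => (η x : ℂ)) :=
    φ.hasCompactSupport_normed.comp_left (g := fun r : ℝ => (r : ℂ)) (by simp)
  have hηcc : ContDiff ℝ ((⊤ : ℕ∞) : WithTop ℕ∞) (fun x => (η x : ℂ)) :=
    Complex.ofRealCLM.contDiff.comp (φ.contDiff_normed (μ := volume))
  let Uc := hUcs.toSchwartzMap hUcc
  let ηc := hηcs.toSchwartzMap hηcc
  have hUcx : ∀ x, Uc x = U x := fun x => rfl
  have hηcx : ∀ x, ηc x = η x := fun x => rfl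
  have hVc : ∀ x, SchwartzMap.convolution (ContinuousLinearMap.mul ℂ ℂ) ηc Uc x = (V x : ℂ) := by
    intro x
    rw [SchwartzMap.convolution_apply]
    simp only [convolution, V, hUcx, hηcx, ContinuousLinearMap.mul_apply']
    rw [← integral_complex_ofReal]
    simp
  have hA : ∀ i, ∫ x, ‖pd Uc i x‖ ^ 2 ≤
      volume.real (Metric.closedBall (0 : EuclideanSpace ℝ (Fin d)) 3) := by
    intro i
    have hLip : LipschitzWith 1 (Uc : EuclideanSpace ℝ (Fin d) → ℂ) := by
      refine LipschitzWith.of_dist_le_mul fun x y => ?_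
      rw [hUcx, hUcx, Complex.dist_of_im_eq (by simp)]
      simpa using hU2.dist_le_mul x y
    have hx : ∀ x, ‖pd Uc i x‖ ≤ 1 := by
      intro x
      rw [pd, SchwartzMap.lineDerivOp_apply_eq_fderiv]
      refine (ContinuousLinearMap.le_opNorm _ _).trans ?_
      have := norm_fderiv_le_of_lipschitz ℝ hLip (x₀ := x)
      simpa using this
    have hx0 : ∀ x ∉ Metric.closedBall (0 : EuclideanSpace ℝ (Fin d)) 3, pd Uc i x = 0 := by
      intro x hx
      rw [pd, SchwartzMap.lineDerivOp_apply_eq_fderiv]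
      have : (Uc : EuclideanSpace ℝ (Fin d) → ℂ) =ᶠ[nhds x] fun _ => 0 := by
        filter_upwards [Metric.isClosed_closedBall.isOpen_compl.mem_nhds hx] with y hy
        simp at hy
        rw [hUcx, hU4 y (by linarith)]
        simp
      rw [this.fderiv_eq]
      simp
    rw [← setIntegral_eq_integral_of_forall_compl_eq_zero
      (s := Metric.closedBall (0 : EuclideanSpace ℝ (Fin d)) 3)
      (fun x hx => by rw [hx0 x hx]; simp)]
    have := norm_setIntegral_le_of_norm_le_const (μ := volume)
      (s := Metric.closedBall (0 : EuclideanSpace ℝ (Fin d)) 3) (C := 1)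
      (f := fun x => ‖pd Uc i x‖ ^ 2) measure_closedBall_lt_top
      (fun x _ => by
        rw [norm_pow, norm_norm]
        exact pow_le_one₀ (norm_nonneg _) (hx x))
    rw [one_mul] at this
    exact (le_abs_self _).trans this
  have hB : ∫ x, ‖ηc x‖ ^ 2 ≤
      1 / volume.real (Metric.closedBall (0 : EuclideanSpace ℝ (Fin d)) (a / 2)) := by
    have h1 : ∫ x, 1 / volume.real (Metric.closedBall (0 : EuclideanSpace ℝ (Fin d)) (a / 2)) * η x
        = 1 / volume.real (Metric.closedBall (0 : EuclideanSpace ℝ (Fin d)) (a / 2)) := by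
      rw [integral_const_mul, φ.integral_normed, mul_one]
    rw [← h1]
    refine integral_mono_of_nonneg (Filter.Eventually.of_forall fun x => by positivity)
      (φ.integrable_normed.const_mul _) (Filter.Eventually.of_forall fun x => ?_)
    simp only [hηcx, Complex.norm_real, Real.norm_eq_abs, sq_abs]
    rw [sq]
    exact mul_le_mul_of_nonneg_right (φ.normed_le_div_measure_closedBall_rIn volume x)
      (φ.nonneg_normed x)
  have key := conv_bound μ ν M hM0 hM Uc ηc _ _ measureReal_nonneg hA hB
  simp_rw [hVc] at key
  rw [integral_complex_ofReal, integral_complex_ofReal, ← Complex.ofReal_sub,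
    Complex.norm_real] at key
  have key2 := le_of_abs_le key
  have hvol : volume.real (Metric.closedBall (0 : EuclideanSpace ℝ (Fin d)) 3) *
      (1 / volume.real (Metric.closedBall (0 : EuclideanSpace ℝ (Fin d)) (a / 2))) = (6 / a) ^ d := by
    have hb : 0 < volume.real (Metric.closedBall (0 : EuclideanSpace ℝ (Fin d)) (a / 2)) :=
      ENNReal.toReal_pos (Metric.measure_closedBall_pos _ _ (by positivity)).ne'
        measure_closedBall_lt_top.ne
    have h3 : volume.real (Metric.closedBall (0 : EuclideanSpace ℝ (Fin d)) 3)
        = (6 / a) ^ d * volume.real (Metric.closedBall (0 : EuclideanSpace ℝ (Fin d)) (a / 2)) := by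
      have := Measure.addHaar_closedBall_mul (volume : Measure (EuclideanSpace ℝ (Fin d))) 0
        (r := 6 / a) (by positivity) (s := a / 2) (by positivity)
      rw [Measure.addHaar_closedBall_center] at this
      have e : 6 / a * (a / 2) = 3 := by field_simp; norm_num
      rw [e] at this
      unfold Measure.real
      rw [this, ENNReal.toReal_mul, ENNReal.toReal_ofReal (by positivity)]
      simp
    rw [h3]
    field_simp
  have hd : (d : ℝ) * √((6 / a) ^ d) ≤ √((24 / a) ^ d) := by
    refine Real.le_sqrt_of_sq_le ?_
    rw [mul_pow, Real.sq_sqrt (by positivity)]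
    have e : (24 / a) ^ d = ((2 : ℝ) ^ d) ^ 2 * (6 / a) ^ d := by
      rw [← pow_mul, mul_comm d 2, pow_mul, ← mul_pow]
      congr 1
      ring
    rw [e]
    gcongr
    exact_mod_cast Nat.lt_two_pow_self.le
  rw [hvol] at key2
  have hbd : ∀ f : EuclideanSpace ℝ (Fin d) → ℝ, Continuous f → (∀ x, 4 ≤ ‖x‖ → f x = 0) →
      ∀ m : Measure (EuclideanSpace ℝ (Fin d)), IsProbabilityMeasure m → Integrable f m := by
    intro f hf h4 m hm
    refine hf.integrable_of_hasCompactSupport ?_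
    refine HasCompactSupport.intro (isCompact_closedBall (0 : EuclideanSpace ℝ (Fin d)) 4) ?_
    intro x hx
    simp at hx
    exact h4 x hx.le
  have hdiff : ∀ m : Measure (EuclideanSpace ℝ (Fin d)), IsProbabilityMeasure m →
      |∫ x, V x ∂m - ∫ x, u x ∂m| ≤ 2 * a := by
    intro m hm
    rw [← integral_sub (hbd V hV2.continuous (fun x hx => hV4 x (by linarith)) m hm)
      (hbd u hu.continuous (fun x hx => hR x (by linarith)) m hm)]
    have := norm_integral_le_of_norm_le_const (μ := m) (f := fun x => V x - u x) (C := 2 * a)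
      (Filter.Eventually.of_forall fun x => by
        have h1 := hU1 x
        have h2 := hV1 x
        rw [Real.norm_eq_abs]
        rw [abs_le] at *
        constructor <;> linarith)
    simpa using this
  have d1 := hdiff μ inferInstance
  have d2 := hdiff ν inferInstance
  rw [abs_le] at d1 d2
  have := mul_le_mul_of_nonneg_left hd hM0
  linarith

lemma lip_bound {d : ℕ} (μ ν : Measure (EuclideanSpace ℝ (Fin d)))
    [IsProbabilityMeasure μ] [IsProbabilityMeasure ν] 
    (hμ : ∀ᵐ x ∂μ, ‖x‖ ≤ 1) (hν : ∀ᵐ x ∂ν, ‖x‖ ≤ 1) (M : ℝ) (hM0 : 0 ≤ M)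
    (hM : ∀ t, ‖charFun μ t - charFun ν t‖ ≤ ‖t‖ * M)
    (u : EuclideanSpace ℝ (Fin d) → ℝ) (hu : LipschitzWith 1 u)
    (a : ℝ) (ha : 0 < a) (ha1 : a ≤ 1) :
    ∫ x, u x ∂μ - ∫ x, u x ∂ν ≤ 4 * a + M * √((24 / a) ^ d) := by
  let w : EuclideanSpace ℝ (Fin d) → ℝ := fun x => max (2 - ‖x‖) 0
  let v : EuclideanSpace ℝ (Fin d) → ℝ := fun x => max (min (u x - u 0) (w x)) (-w x)
  have hw : LipschitzWith 1 w := by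
    have h1 : LipschitzWith 1 fun x : EuclideanSpace ℝ (Fin d) => 2 - ‖x‖ := by
      refine LipschitzWith.of_le_add_mul _ fun x y => ?_
      have := norm_sub_norm_le y x
      rw [← dist_eq_norm, dist_comm] at this
      simp
      linarith
    exact h1.max_const 0
  have hu' : LipschitzWith 1 fun x => u x - u 0 := by
    refine LipschitzWith.of_dist_le_mul fun x y => ?_
    rw [dist_sub_right]
    exact hu.dist_le_mul x y
  have hv : LipschitzWith 1 v := by
    have := (hu'.min hw).max hw.neg
    simpa using this
  have hv0 : ∀ x, 2 ≤ ‖x‖ → v x = 0 := by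
    intro x hx
    have : w x = 0 := max_eq_right (by linarith)
    simp [v, this]
  have hvu : ∀ x, ‖x‖ ≤ 1 → v x = u x - u 0 := by
    intro x hx
    have h1 : w x = 2 - ‖x‖ := max_eq_left (by linarith)
    have h2 := hu.dist_le_mul x 0
    rw [Real.dist_eq, dist_zero_right] at h2
    simp at h2
    rw [abs_le] at h2
    simp only [v]
    rw [min_eq_left (by linarith), max_eq_left (by linarith)]
  have hI : ∀ m : Measure (EuclideanSpace ℝ (Fin d)), IsProbabilityMeasure m →
      (∀ᵐ x ∂m, ‖x‖ ≤ 1) → ∫ x, v x ∂m = ∫ x, u x ∂m - u 0 := by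
    intro m hm h1
    have hiv : Integrable v m := by
      refine hv.continuous.integrable_of_hasCompactSupport ?_
      refine HasCompactSupport.intro (isCompact_closedBall (0 : EuclideanSpace ℝ (Fin d)) 2) ?_
      intro x hx
      simp at hx
      exact hv0 x hx.le
    have hae : (fun x => v x + u 0) =ᵐ[m] u := by
      filter_upwards [h1] with x hx
      rw [hvu x hx]
      ring
    rw [← integral_congr_ae hae, integral_add hiv (integrable_const _)]
    simp
  have := main_bound μ ν M hM0 hM v hv hv0 a ha ha1
  rw [hI μ inferInstance hμ, hI ν inferInstance hν] at this
  linarith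

/-- **Cramér–Wold theorem for the Kantorovich distance, compactly supported case** (inequality (1.2)).
If `μ, ν` are probability measures supported on the closed unit ball of `ℝ^d`, then
`W(μ,ν) ≤ c (sup_{|θ|=1} W(μ_θ,ν_θ))^β` with `β = 2/(2+d)`, for an absolute constant `c > 0`. -/
theorem cramer_wold_kantorovich_ball :
    ∃ c : ℝ, 0 < c ∧ ∀ (d : ℕ),
    ∀ (μ ν : Measure (EuclideanSpace ℝ (Fin d))),
      IsProbabilityMeasure μ → IsProbabilityMeasure ν →
      μ (Metric.closedBall (0 : EuclideanSpace ℝ (Fin d)) 1) = 1 →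
      ν (Metric.closedBall (0 : EuclideanSpace ℝ (Fin d)) 1) = 1 →
      kantorovichW μ ν ≤
        c * (⨆ θ : Metric.sphere (0 : EuclideanSpace ℝ (Fin d)) 1,
            kantorovichW (μ.map (fun x => ⟪x, (θ : EuclideanSpace ℝ (Fin d))⟫))
              (ν.map (fun x => ⟪x, (θ : EuclideanSpace ℝ (Fin d))⟫))) ^
          (2 / (2 + (d : ℝ))) := by
  refine ⟨97, by norm_num, ?_⟩
  intro d μ ν pμ pν hμ hν
  have hμ' : ∀ᵐ x ∂μ, x ∈ Metric.closedBall (0 : EuclideanSpace ℝ (Fin d)) 1 :=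
    (prob_compl_eq_zero_iff measurableSet_closedBall).2 hμ
  have hν' : ∀ᵐ x ∂ν, x ∈ Metric.closedBall (0 : EuclideanSpace ℝ (Fin d)) 1 :=
    (prob_compl_eq_zero_iff measurableSet_closedBall).2 hν
  have hμ1 : ∀ᵐ x ∂μ, ‖x‖ ≤ 1 := by simpa using hμ'
  have hν1 : ∀ᵐ x ∂ν, ‖x‖ ≤ 1 := by simpa using hν'
  have hM := charFun_diff_le' μ ν hμ1 hν1
  set M := (⨆ θ : Metric.sphere (0 : EuclideanSpace ℝ (Fin d)) 1,
            kantorovichW (μ.map (fun x => ⟪x, (θ : EuclideanSpace ℝ (Fin d))⟫))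
              (ν.map (fun x => ⟪x, (θ : EuclideanSpace ℝ (Fin d))⟫)))
  have hM0 : 0 ≤ M := Real.iSup_nonneg fun θ => ENNReal.toReal_nonneg
  have hW : ∀ a : ℝ, 0 < a → a ≤ 1 → kantorovichW μ ν ≤ 4 * a + M * √((24 / a) ^ d) :=
    fun a ha ha1 => W_le_of_dual μ ν hμ' hν' _ fun u hu =>
      lip_bound μ ν hμ1 hν1 M hM0 hM u hu a ha ha1
  have hβ : 0 < 2 / (2 + (d : ℝ)) := by positivity
  rcases hM0.eq_or_lt with h0 | h0
  · rw [← h0, Real.zero_rpow hβ.ne', mul_zero]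
    refine le_of_forall_pos_le_add fun ε hε => ?_
    have h1 := hW (min (ε / 4) 1) (by positivity) (min_le_right _ _)
    rw [← h0, zero_mul] at h1
    have h2 := min_le_left (ε / 4) 1
    linarith
  set b := M ^ (2 / (2 + (d : ℝ))) with hb
  have hb0 : 0 < b := Real.rpow_pos_of_pos h0 _
  by_cases h1 : 24 * b ≤ 1
  · have h2 := hW (24 * b) (by positivity) h1
    have e : 24 / (24 * b) = b⁻¹ := by field_simp
    have hbd : √(b ^ d) = M ^ ((d : ℝ) / (2 + d)) := by
      rw [Real.sqrt_eq_rpow, ← Real.rpow_natCast, ← Real.rpow_mul hb0.le, hb,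
        ← Real.rpow_mul h0.le]
      congr 1
      field_simp
    have hMb : M * √((24 / (24 * b)) ^ d) = b := by
      rw [e, inv_pow, Real.sqrt_inv, hbd, ← div_eq_mul_inv, hb]
      nth_rewrite 1 [← Real.rpow_one M]
      rw [← Real.rpow_sub h0]
      congr 1
      field_simp
      ring
    rw [hMb] at h2
    linarith
  · have h2 : kantorovichW μ ν ≤ 2 := ENNReal.toReal_le_of_le_ofReal (by norm_num)
      ((inf_le_two _ _ hμ1 hν1).trans (by simp))
    linarith
end
end

section
/- Let p ≥ 1 be an integer and let λ be a finite signed Borel measure on ℝ^d with ∫|x|^p d|λ|(x) < ∞ satisfying ∫ x^α dλ(x) = 0 for all multi-indices α with |α| ≤ p−1. Then ‖λ‖_{ζ_p} ≤ (1/p!) · d^{p/2} · ∫ |x|^p d|λ|(x). -/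
open MeasureTheory
open scoped RealInnerProductSpace ENNReal NNReal

noncomputable section


/-- The list of coordinate directions encoded by a multi-index `α` on `ℝ^d`:
the direction `i` is repeated `α i` times, so the list has length `|α| = ∑ i, α i`. -/
def multiIndexDirs {d : ℕ} (α : Fin d → ℕ) : List (Fin d) :=
  (List.finRange d).flatMap fun i => List.replicate (α i) i

/-- `D^α u (x)`: the partial derivative of `u` at `x` corresponding to the multi-index `α`
(of order `|α| = ∑ i, α i`), as an iterated derivative in the coordinate directions. -/
def mderiv {d : ℕ} (α : Fin d → ℕ) (u : EuclideanSpace ℝ (Fin d) → ℝ)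
    (x : EuclideanSpace ℝ (Fin d)) : ℝ :=
  iteratedFDeriv ℝ (multiIndexDirs α).length u x
    (fun k => EuclideanSpace.single ((multiIndexDirs α).get k) 1)


/-- The integral `∫ f dλ` of `f` with respect to a finite signed measure `λ`. -/
def sIntegral {X : Type*} [MeasurableSpace X] (lam : SignedMeasure X) (f : X → ℝ) : ℝ :=
  (∫ x, f x ∂lam.toJordanDecomposition.posPart) - ∫ x, f x ∂lam.toJordanDecomposition.negPart

/-- The total variation norm `‖λ‖_TV` of a finite signed measure `λ`. -/
def tvNorm {X : Type*} [MeasurableSpace X] (lam : SignedMeasure X) : ℝ :=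
  (lam.totalVariation Set.univ).toReal


/-- The Zolotarev semi-norm `‖λ‖_{ζ_p}` of a finite signed measure on `ℝ^d`:
the supremum of `|∫ u dλ|` over all `C^∞`-smooth `u : ℝ^d → ℝ` whose
partial derivatives of order `p` are bounded by `1` in absolute value. -/
def zolotarevSemi {d : ℕ} (p : ℕ) (lam : SignedMeasure (EuclideanSpace ℝ (Fin d))) : ℝ :=
  sSup { z | ∃ u : EuclideanSpace ℝ (Fin d) → ℝ, ContDiff ℝ (⊤ : ℕ∞) u ∧
    (∀ α : Fin d → ℕ, (∑ i, α i) = p → ∀ x, |mderiv α u x| ≤ 1) ∧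
    z = |sIntegral lam u| }


lemma zz_cast {d n m : ℕ} (h : m = n) (u : EuclideanSpace ℝ (Fin d) → ℝ)
    (x : EuclideanSpace ℝ (Fin d)) (v : Fin m → EuclideanSpace ℝ (Fin d)) :
    iteratedFDeriv ℝ m u x v = iteratedFDeriv ℝ n u x (fun j => v (Fin.cast h.symm j)) := by
  subst h; rfl

/-- multi-index of a tuple of directions -/
def zzIdx {d n : ℕ} (r : Fin n → Fin d) (i : Fin d) : ℕ := (Finset.univ.filter fun j => r j = i).card

lemma zzIdx_sum {d n : ℕ} (r : Fin n → Fin d) : ∑ i, zzIdx r i = n := by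
  have := Finset.card_eq_sum_card_fiberwise (s := (Finset.univ : Finset (Fin n)))
    (t := (Finset.univ : Finset (Fin d))) (f := r) (by intro _ _; simp)
  simpa [zzIdx] using this.symm

lemma zzIdx_prod {d n : ℕ} (r : Fin n → Fin d) (y : Fin d → ℝ) :
    ∏ j, y (r j) = ∏ i, y i ^ zzIdx r i := by
  rw [← Finset.prod_fiberwise' Finset.univ r y]
  simp [zzIdx]

lemma zz_dirs_perm {d n : ℕ} (r : Fin n → Fin d) :
    (List.ofFn r).Perm (multiIndexDirs (zzIdx r)) := by
  rw [List.perm_iff_count]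
  intro a
  unfold multiIndexDirs
  rw [List.count_flatMap]
  have h1 : (List.ofFn r).count a = zzIdx r a := by
    rw [List.ofFn_eq_map, List.count, List.countP_map]
    unfold zzIdx
    rw [Finset.card_def, Finset.filter_val, ← Multiset.countP_eq_card_filter]
    show _ = Multiset.countP _ (↑(List.finRange n) : Multiset (Fin n))
    rw [Multiset.coe_countP]
    rfl
  rw [h1]
  have : (List.map (List.count a ∘ fun i => List.replicate (zzIdx r i) i) (List.finRange d)).sum
     = ∑ i, (List.replicate (zzIdx r i) i).count a := by
    rw [← List.sum_ofFn, List.ofFn_eq_map]; rfl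
  rw [this]
  simp [List.count_replicate]

/-- iterated coordinate derivative along a list -/
def zzD {d : ℕ} : List (Fin d) → (EuclideanSpace ℝ (Fin d) → ℝ) → EuclideanSpace ℝ (Fin d) → ℝ
  | [], u => u
  | a :: l, u => fun x => fderiv ℝ (zzD l u) x (EuclideanSpace.single a 1)

lemma zzD_smooth {d : ℕ} (u : EuclideanSpace ℝ (Fin d) → ℝ) (hu : ContDiff ℝ (⊤ : ℕ∞) u)
    (l : List (Fin d)) : ContDiff ℝ (⊤ : ℕ∞) (zzD l u) := by
  induction l with
  | nil => exact hu
  | cons a l ih => exact (ih.fderiv_right (by simp)).clm_apply contDiff_const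

lemma zzD_eq {d : ℕ} (u : EuclideanSpace ℝ (Fin d) → ℝ) (hu : ContDiff ℝ (⊤ : ℕ∞) u)
    (l : List (Fin d)) : ∀ x,
    iteratedFDeriv ℝ l.length u x (fun k => EuclideanSpace.single (l.get k) 1) = zzD l u x := by
  induction l with
  | nil => intro x; simp [zzD]
  | cons a l ih =>
    intro x
    have hd : DifferentiableAt ℝ (iteratedFDeriv ℝ l.length u) x :=
      (hu.differentiable_iteratedFDeriv (by exact_mod_cast ENat.natCast_lt_top _)) x
    show iteratedFDeriv ℝ (l.length + 1) u x _ = fderiv ℝ (zzD l u) x _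
    rw [iteratedFDeriv_succ_apply_left]
    have : zzD l u = fun y => iteratedFDeriv ℝ l.length u y
        (fun k => EuclideanSpace.single (l.get k) 1) := by
      funext y; exact (ih y).symm
    rw [this, fderiv_continuousMultilinear_apply_const_apply hd]
    rfl

lemma zzD_perm {d : ℕ} (u : EuclideanSpace ℝ (Fin d) → ℝ) (hu : ContDiff ℝ (⊤ : ℕ∞) u)
    {l m : List (Fin d)} (h : l.Perm m) : zzD l u = zzD m u := by
  induction h with
  | nil => rfl
  | cons a _ ih => simp only [zzD, ih]
  | swap a b l =>
    funext x
    have hs := zzD_smooth u hu l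
    have hd : DifferentiableAt ℝ (fderiv ℝ (zzD l u)) x :=
      (hs.fderiv_right (m := (⊤ : ℕ∞)) (by simp)).differentiable (by simp) x
    have hsym : IsSymmSndFDerivAt ℝ (zzD l u) x :=
      hs.contDiffAt.isSymmSndFDerivAt (by
        rw [minSmoothness_of_isRCLikeNormedField]
        have : ((2 : ℕ∞) : WithTop ℕ∞) ≤ ((⊤ : ℕ∞) : WithTop ℕ∞) := WithTop.coe_le_coe.2 le_top
        exact this)
    simp only [zzD]
    rw [fderiv_clm_apply hd (by fun_prop), fderiv_clm_apply hd (by fun_prop)]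
    simpa using hsym.eq _ _
  | trans _ _ h1 h2 => exact h1.trans h2

lemma zz_deriv {d n : ℕ} (u : EuclideanSpace ℝ (Fin d) → ℝ) (hu : ContDiff ℝ (⊤ : ℕ∞) u)
    (x : EuclideanSpace ℝ (Fin d)) (r : Fin n → Fin d) :
    iteratedFDeriv ℝ n u x (fun j => EuclideanSpace.single (r j) 1) = mderiv (zzIdx r) u x := by
  unfold mderiv
  rw [zzD_eq u hu, ← zzD_perm u hu (zz_dirs_perm r), ← zzD_eq u hu,
    zz_cast (List.length_ofFn (f := r))]
  simp

lemma zz_expand {d n : ℕ} (u : EuclideanSpace ℝ (Fin d) → ℝ) (hu : ContDiff ℝ (⊤ : ℕ∞) u)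
    (x y : EuclideanSpace ℝ (Fin d)) :
    iteratedFDeriv ℝ n u x (fun _ => y) =
      ∑ r : Fin n → Fin d, (∏ j, y (r j)) * mderiv (zzIdx r) u x := by
  have hy : y = ∑ i, y i • EuclideanSpace.single i (1 : ℝ) := by
    ext k
    simp [Finset.sum_apply, Pi.single_apply]
  conv_lhs => rw [hy]
  rw [ContinuousMultilinearMap.map_sum]
  refine Finset.sum_congr rfl fun r _ => ?_
  rw [ContinuousMultilinearMap.map_smul_univ, zz_deriv u hu, smul_eq_mul]

lemma zz_l1 {d : ℕ} (y : EuclideanSpace ℝ (Fin d)) : ∑ i, |y i| ≤ √d * ‖y‖ := by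
  rw [EuclideanSpace.norm_eq, ← Real.sqrt_mul (by positivity)]
  apply Real.le_sqrt_of_sq_le
  have := sq_sum_le_card_mul_sum_sq (s := Finset.univ) (f := fun i => |y i|)
  simpa using this

lemma zz_bound {d n : ℕ} (u : EuclideanSpace ℝ (Fin d) → ℝ) (hu : ContDiff ℝ (⊤ : ℕ∞) u)
    (hb : ∀ α : Fin d → ℕ, (∑ i, α i) = n → ∀ x, |mderiv α u x| ≤ 1)
    (x y : EuclideanSpace ℝ (Fin d)) :
    |iteratedFDeriv ℝ n u x (fun _ => y)| ≤ (√d) ^ n * ‖y‖ ^ n := by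
  rw [zz_expand u hu, ← mul_pow]
  calc _ ≤ ∑ r : Fin n → Fin d, ∏ j, |y (r j)| := by
        refine (Finset.abs_sum_le_sum_abs _ _).trans (Finset.sum_le_sum fun r _ => ?_)
        rw [abs_mul, Finset.abs_prod]
        exact mul_le_of_le_one_right (Finset.prod_nonneg fun _ _ => abs_nonneg _)
          (hb _ (zzIdx_sum r) x)
    _ = (∑ i, |y i|) ^ n := by
        rw [← Fintype.prod_sum (fun (_ : Fin n) (i : Fin d) => |y i|)]
        simp
    _ ≤ _ := by
        gcongr
        exact zz_l1 y

lemma zz_taylor {d n : ℕ} (u : EuclideanSpace ℝ (Fin d) → ℝ) (hu : ContDiff ℝ (⊤ : ℕ∞) u)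
    (hb : ∀ α : Fin d → ℕ, (∑ i, α i) = n + 1 → ∀ x, |mderiv α u x| ≤ 1)
    (y : EuclideanSpace ℝ (Fin d)) :
    |u y - ∑ k ∈ Finset.range (n + 1), (k.factorial : ℝ)⁻¹ * iteratedFDeriv ℝ k u 0 (fun _ => y)|
      ≤ ((n + 1).factorial : ℝ)⁻¹ * ((√d) ^ (n + 1) * ‖y‖ ^ (n + 1)) := by
  have h := map_add_eq_sum_add_integral_iteratedFDeriv (f := u) (n := n) (x := 0) (y := y)
    (fun t _ => (hu.of_le (by exact_mod_cast le_top)).contDiffAt)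
  simp only [zero_add, smul_eq_mul] at h
  rw [h, add_sub_cancel_left, abs_mul, Nat.factorial_succ]
  set C := (√d) ^ (n + 1) * ‖y‖ ^ (n + 1) with hC
  have h1 : |∫ t in (0 : ℝ)..1, (1 - t) ^ n * iteratedFDeriv ℝ (n + 1) u (t • y) (fun _ => y)|
      ≤ ∫ t in (0 : ℝ)..1, (1 - t) ^ n * C := by
    rw [← Real.norm_eq_abs]
    refine intervalIntegral.norm_integral_le_of_norm_le zero_le_one ?_ ?_
    · refine Filter.Eventually.of_forall fun t ht => ?_
      rw [norm_mul, norm_pow, Real.norm_eq_abs, Real.norm_eq_abs, abs_of_nonneg (by linarith [ht.2])]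
      exact mul_le_mul_of_nonneg_left (zz_bound u hu hb _ _) (pow_nonneg (by linarith [ht.2]) _)
    · exact Continuous.intervalIntegrable (by fun_prop) _ _
  have h2 : ∫ t in (0 : ℝ)..1, (1 - t) ^ n * C = ((n : ℝ) + 1)⁻¹ * C := by
    rw [intervalIntegral.integral_mul_const,
      intervalIntegral.integral_comp_sub_left (fun t => t ^ n) 1]
    simp
  rw [h2] at h1
  rw [abs_of_nonneg (by positivity)]
  push_cast
  rw [mul_inv, mul_comm ((n : ℝ) + 1)⁻¹, mul_assoc]
  gcongr

/-- **Corollary 2.4.** If a finite signed measure `λ` on `ℝ^d` has finite `p`-th absolute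
moment and vanishing mixed moments up to order `p-1`, then
`‖λ‖_{ζ_p} ≤ (1/p!) d^{p/2} ∫ |x|^p d|λ|(x)`. -/
theorem zolotarevSemi_le_moment (d p : ℕ) (hp : 1 ≤ p)
    (lam : SignedMeasure (EuclideanSpace ℝ (Fin d)))
    (hmom : ∫⁻ x, (‖x‖₊ : ℝ≥0∞) ^ p ∂lam.totalVariation < ⊤)
    (hvan : ∀ α : Fin d → ℕ, (∑ i, α i) ≤ p - 1 →
      sIntegral lam (fun x => ∏ i, x i ^ α i) = 0) :
    zolotarevSemi p lam ≤
      (1 / (Nat.factorial p : ℝ)) * (d : ℝ) ^ ((p : ℝ) / 2) *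
        ∫ x, ‖x‖ ^ p ∂lam.totalVariation := by
  obtain ⟨n, rfl⟩ : ∃ n, p = n + 1 := ⟨p - 1, by omega⟩
  set P := lam.toJordanDecomposition.posPart with hP
  set N := lam.toJordanDecomposition.negPart with hN
  have hTV : lam.totalVariation = P + N := rfl
  have hint : Integrable (fun x : EuclideanSpace ℝ (Fin d) => ‖x‖ ^ (n + 1)) (P + N) := by
    refine ⟨by fun_prop, ?_⟩
    rw [hasFiniteIntegral_iff_enorm]
    rw [hTV] at hmom
    refine lt_of_le_of_lt (le_of_eq ?_) hmom
    refine lintegral_congr fun x => ?_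
    rw [enorm_pow, enorm_norm]; rfl
  have hsq : (d : ℝ) ^ (((n + 1 : ℕ) : ℝ) / 2) = (√d) ^ (n + 1) := by
    rw [Real.sqrt_eq_rpow, ← Real.rpow_natCast, ← Real.rpow_mul (by positivity)]
    congr 1; ring
  rw [hsq, hTV]
  refine Real.sSup_le ?_ (by positivity)
  rintro z ⟨u, hu, hb, rfl⟩
  -- monomials
  have hmono : ∀ k ≤ n, ∀ r : Fin k → Fin d,
      Integrable (fun x : EuclideanSpace ℝ (Fin d) => ∏ j, x (r j)) (P + N) := by
    intro k hk r
    refine Integrable.mono' ((integrable_const (1 : ℝ)).add hint) ?_ ?_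
    · exact (Continuous.aestronglyMeasurable (by fun_prop))
    · refine Filter.Eventually.of_forall fun x => ?_
      rw [norm_prod]
      have h1 : ∏ j, ‖x (r j)‖ ≤ ‖x‖ ^ k := by
        refine (Finset.prod_le_prod (fun j _ => norm_nonneg _)
          fun j _ => PiLp.norm_apply_le x (r j)).trans ?_
        simp
      refine h1.trans ?_
      show ‖x‖ ^ k ≤ 1 + ‖x‖ ^ (n + 1)
      rcases le_total ‖x‖ 1 with h | h
      · have := pow_le_one₀ (n := k) (norm_nonneg x) h
        have := pow_nonneg (norm_nonneg x) (n + 1)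
        linarith
      · have := pow_le_pow_right₀ h (show k ≤ n + 1 by omega)
        linarith
  set T : EuclideanSpace ℝ (Fin d) → ℝ := fun y => ∑ k ∈ Finset.range (n + 1),
    (k.factorial : ℝ)⁻¹ * ∑ r : Fin k → Fin d, (∏ j, y (r j)) * mderiv (zzIdx r) u 0 with hT
  have hTint : Integrable T (P + N) := by
    refine integrable_finsetSum _ fun k hk => Integrable.const_mul ?_ _
    refine integrable_finsetSum _ fun r _ => Integrable.mul_const ?_ _
    exact hmono k (by simp at hk; omega) r
  have hR : ∀ y, |u y - T y| ≤
      ((n + 1).factorial : ℝ)⁻¹ * ((√d) ^ (n + 1) * ‖y‖ ^ (n + 1)) := by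
    intro y
    have := zz_taylor u hu hb y
    simpa only [zz_expand u hu] using this
  have hbi : Integrable (fun y : EuclideanSpace ℝ (Fin d) =>
      ((n + 1).factorial : ℝ)⁻¹ * ((√d) ^ (n + 1) * ‖y‖ ^ (n + 1))) (P + N) :=
    (hint.const_mul _).const_mul _
  have hRint : Integrable (fun y => u y - T y) (P + N) := by
    refine Integrable.mono' hbi ?_ (Filter.Eventually.of_forall hR)
    refine Continuous.aestronglyMeasurable (hu.continuous.sub ?_)
    rw [hT]; fun_prop
  have hTz : ∫ y, T y ∂P = ∫ y, T y ∂N := by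
    have key : ∀ M : Measure (EuclideanSpace ℝ (Fin d)), M ≤ P + N → ∫ y, T y ∂M =
        ∑ k ∈ Finset.range (n + 1), (k.factorial : ℝ)⁻¹ * ∑ r : Fin k → Fin d,
          (∫ y, ∏ i, y i ^ zzIdx r i ∂M) * mderiv (zzIdx r) u 0 := by
      intro M hM
      have hm : ∀ k ∈ Finset.range (n + 1), ∀ r : Fin k → Fin d,
          Integrable (fun x : EuclideanSpace ℝ (Fin d) => ∏ j, x (r j)) M :=
        fun k hk r => (hmono k (by simp at hk; omega) r).mono_measure hM
      rw [hT, integral_finsetSum _ fun k hk => Integrable.const_mul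
        (integrable_finsetSum _ fun r _ => (hm k hk r).mul_const _) _]
      refine Finset.sum_congr rfl fun k hk => ?_
      rw [integral_const_mul, integral_finsetSum _ fun r _ => (hm k hk r).mul_const _]
      congr 1
      refine Finset.sum_congr rfl fun r _ => ?_
      rw [integral_mul_const]
      congr 1
      exact integral_congr_ae (Filter.Eventually.of_forall fun y => zzIdx_prod r y)
    rw [key P (Measure.le_add_right le_rfl), key N (Measure.le_add_left le_rfl)]
    refine Finset.sum_congr rfl fun k hk => ?_
    congr 1
    refine Finset.sum_congr rfl fun r _ => ?_
    congr 1
    have := hvan (zzIdx r) (by rw [zzIdx_sum]; simp at hk; omega)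
    exact sub_eq_zero.1 this
  have hs : sIntegral lam u = ∫ y, (u y - T y) ∂P - ∫ y, (u y - T y) ∂N := by
    have huint : Integrable u (P + N) := by
      have := hRint.add hTint
      refine this.congr (Filter.Eventually.of_forall fun y => by simp)
    have h1 := integral_sub (huint.left_of_add_measure) (hTint.left_of_add_measure)
    have h2 := integral_sub (huint.right_of_add_measure) (hTint.right_of_add_measure)
    rw [h1, h2, hTz]
    unfold sIntegral
    ring
  rw [hs]
  calc _ ≤ |∫ y, (u y - T y) ∂P| + |∫ y, (u y - T y) ∂N| := by
        simpa only [Real.norm_eq_abs] using norm_sub_le (∫ y, (u y - T y) ∂P) (∫ y, (u y - T y) ∂N)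
    _ ≤ (∫ y, |u y - T y| ∂P) + ∫ y, |u y - T y| ∂N :=
        add_le_add abs_integral_le_integral_abs abs_integral_le_integral_abs
    _ = ∫ y, |u y - T y| ∂(P + N) :=
        (integral_add_measure hRint.abs.left_of_add_measure hRint.abs.right_of_add_measure).symm
    _ ≤ ∫ y, ((n + 1).factorial : ℝ)⁻¹ * ((√d) ^ (n + 1) * ‖y‖ ^ (n + 1)) ∂(P + N) :=
        integral_mono hRint.abs hbi hR
    _ = _ := by
        rw [integral_const_mul, integral_const_mul, one_div, mul_assoc]
end
end

section
/- Let p ≥ 1 be an integer and let κ be a finite signed Borel measure supported on the closed unit ball B_1 of ℝ^d with κ(B_1) = 1 and ∫ x^α dκ(x) = 0 for all multi-indices α with 1 ≤ |α| ≤ p−1. For ε > 0 let κ_ε be the image of κ under the map x ↦ εx. Then for every finite signed Borel measure λ on ℝ^d with ∫|x|^p d|λ|(x) < ∞, the convolution λ_ε = λ ∗ κ_ε satisfies ‖λ_ε − λ‖_{ζ_p} ≤ ((dε)^p / p!) · ‖λ‖_{TV} · ‖κ‖_{TV}. -/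
open MeasureTheory
open scoped RealInnerProductSpace ENNReal NNReal

noncomputable section


/-- The convolution of two finite signed measures, defined via Jordan decompositions. -/
def sConv {d : ℕ} (lam kap : SignedMeasure (EuclideanSpace ℝ (Fin d))) :
    SignedMeasure (EuclideanSpace ℝ (Fin d)) :=
  ((lam.toJordanDecomposition.posPart.conv kap.toJordanDecomposition.posPart
    + lam.toJordanDecomposition.negPart.conv kap.toJordanDecomposition.negPart).toSignedMeasure)
  - ((lam.toJordanDecomposition.posPart.conv kap.toJordanDecomposition.negPart
    + lam.toJordanDecomposition.negPart.conv kap.toJordanDecomposition.posPart).toSignedMeasure)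


def Dl {d : ℕ} (u : EuclideanSpace ℝ (Fin d) → ℝ) :
    List (Fin d) → EuclideanSpace ℝ (Fin d) → ℝ
  | [] => u
  | a :: l => fun x => fderiv ℝ (Dl u l) x (EuclideanSpace.single a 1)

lemma Dl_contDiff {d : ℕ} {u : EuclideanSpace ℝ (Fin d) → ℝ} (hu : ContDiff ℝ (⊤ : ℕ∞) u)
    (l : List (Fin d)) : ContDiff ℝ (⊤ : ℕ∞) (Dl u l) := by
  induction l with
  | nil => exact hu
  | cons a l ih =>
    have := ih.fderiv_right (m := (⊤ : ℕ∞)) (by simp)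
    exact this.clm_apply contDiff_const

lemma Dl_perm {d : ℕ} {u : EuclideanSpace ℝ (Fin d) → ℝ} (hu : ContDiff ℝ (⊤ : ℕ∞) u)
    {l l' : List (Fin d)} (h : l.Perm l') : Dl u l = Dl u l' := by
  induction h with
  | nil => rfl
  | cons a _ ih => funext x; simp only [Dl, ih]
  | trans _ _ ih1 ih2 => rw [ih1, ih2]
  | swap a b l =>
    funext x
    have hg := Dl_contDiff hu l
    have hd : DifferentiableAt ℝ (fderiv ℝ (Dl u l)) x :=
      (hg.fderiv_right (m := (⊤ : ℕ∞)) (by simp)).differentiable (by simp) x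
    have key : ∀ v w : EuclideanSpace ℝ (Fin d),
        fderiv ℝ (fun x => fderiv ℝ (Dl u l) x v) x w = fderiv ℝ (fderiv ℝ (Dl u l)) x w v := by
      intro v w
      rw [fderiv_clm_apply hd (by fun_prop)]
      simp
    have hs : IsSymmSndFDerivAt ℝ (Dl u l) x :=
      hg.contDiffAt.isSymmSndFDerivAt (by simp only [minSmoothness_of_isRCLikeNormedField]; exact WithTop.coe_le_coe.mpr (le_top : (2 : ℕ∞) ≤ ⊤))
    simp only [Dl, key]
    exact hs _ _

lemma iteratedFDeriv_eq_Dl {d : ℕ} {u : EuclideanSpace ℝ (Fin d) → ℝ}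
    (hu : ContDiff ℝ (⊤ : ℕ∞) u) (n : ℕ) (f : Fin n → Fin d) (x) :
    iteratedFDeriv ℝ n u x (fun k => EuclideanSpace.single (f k) (1 : ℝ)) = Dl u (List.ofFn f) x := by
  induction n generalizing x with
  | zero => simp [Dl]
  | succ n ih =>
    have hd : DifferentiableAt ℝ (iteratedFDeriv ℝ n u) x :=
      hu.differentiable_iteratedFDeriv (by exact_mod_cast WithTop.coe_lt_top _) x
    rw [hd.iteratedFDeriv_succ_apply_left', List.ofFn_succ]
    simp only [Dl]
    congr 2
    funext y
    exact ih (fun i => f i.succ) y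

lemma count_multiIndexDirs {d : ℕ} (α : Fin d → ℕ) (i : Fin d) :
    (multiIndexDirs α).count i = α i := by
  unfold multiIndexDirs
  rw [List.count_flatMap]
  have : (List.count i ∘ fun i => List.replicate (α i) i) = fun j => if j = i then α j else 0 := by
    funext j
    simp [List.count_replicate]
  rw [this, ← List.ofFn_eq_map, List.sum_ofFn]
  simp

lemma deriv_bound {d p : ℕ} {u : EuclideanSpace ℝ (Fin d) → ℝ} (hu : ContDiff ℝ (⊤ : ℕ∞) u)
    (hb : ∀ α : Fin d → ℕ, (∑ i, α i) = p → ∀ x, |mderiv α u x| ≤ 1)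
    (f : Fin p → Fin d) (x) :
    |iteratedFDeriv ℝ p u x (fun k => EuclideanSpace.single (f k) (1 : ℝ))| ≤ 1 := by
  have h := hb (fun i => (List.ofFn f).count i) (by
    have := Multiset.sum_count_eq_card (s := Finset.univ) (m := (List.ofFn f : Multiset (Fin d)))
      (by simp)
    simpa using this) x
  unfold mderiv at h
  rw [iteratedFDeriv_eq_Dl hu, List.ofFn_get] at h
  rw [iteratedFDeriv_eq_Dl hu]
  rwa [Dl_perm hu (l := List.ofFn f) (l' := multiIndexDirs _)]
  rw [List.perm_iff_count]
  intro i
  rw [count_multiIndexDirs]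

lemma multilin_expand {d k : ℕ} (T : ContinuousMultilinearMap ℝ
    (fun _ : Fin k => EuclideanSpace ℝ (Fin d)) ℝ) (y : EuclideanSpace ℝ (Fin d)) :
    T (fun _ => y) = ∑ f : Fin k → Fin d,
      (∏ j, y (f j)) * T (fun j => EuclideanSpace.single (f j) (1 : ℝ)) := by
  have hy : y = ∑ i, y i • EuclideanSpace.single i (1 : ℝ) := by
    have := (EuclideanSpace.basisFun (Fin d) ℝ).sum_repr y
    simpa using this.symm
  conv_lhs => rw [hy]
  rw [T.map_sum]
  simp_rw [T.map_smul_univ, smul_eq_mul]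

lemma top_bound {d p : ℕ} {u : EuclideanSpace ℝ (Fin d) → ℝ} (hu : ContDiff ℝ (⊤ : ℕ∞) u)
    (hb : ∀ α : Fin d → ℕ, (∑ i, α i) = p → ∀ x, |mderiv α u x| ≤ 1)
    (x y : EuclideanSpace ℝ (Fin d)) :
    |iteratedFDeriv ℝ p u x (fun _ => y)| ≤ ((d : ℝ) * ‖y‖) ^ p := by
  rw [multilin_expand]
  calc _ ≤ ∑ f : Fin p → Fin d, ‖y‖ ^ p := by
        refine (Finset.abs_sum_le_sum_abs _ _).trans (Finset.sum_le_sum fun f _ => ?_)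
        rw [abs_mul, Finset.abs_prod]
        have h1 : ∏ j, |y (f j)| ≤ ‖y‖ ^ p := by
          refine (Finset.prod_le_prod (fun _ _ => abs_nonneg _)
            (fun j _ => PiLp.norm_apply_le y (f j))).trans ?_
          simp
        calc _ ≤ ‖y‖ ^ p * 1 := mul_le_mul h1 (deriv_bound hu hb f x) (abs_nonneg _) (by positivity)
          _ = _ := mul_one _
    _ = _ := by simp [mul_pow]

lemma taylor_bound {d p : ℕ} (hp : 1 ≤ p) {u : EuclideanSpace ℝ (Fin d) → ℝ}
    (hu : ContDiff ℝ (⊤ : ℕ∞) u)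
    (hb : ∀ α : Fin d → ℕ, (∑ i, α i) = p → ∀ x, |mderiv α u x| ≤ 1)
    (x y : EuclideanSpace ℝ (Fin d)) :
    |u (x + y) - ∑ k ∈ Finset.range p, (k.factorial : ℝ)⁻¹ * iteratedFDeriv ℝ k u x (fun _ => y)|
      ≤ ((d : ℝ) * ‖y‖) ^ p / p.factorial := by
  obtain ⟨n, rfl⟩ : ∃ n, p = n + 1 := ⟨p - 1, by omega⟩
  rw [map_add_eq_sum_add_integral_iteratedFDeriv (n := n) (f := u) (x := x) (y := y)
    (fun t _ => (hu.of_le (by exact_mod_cast le_top)).contDiffAt)]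
  simp only [smul_eq_mul, add_sub_cancel_left]
  have hI : ‖∫ t in (0:ℝ)..1, (1 - t) ^ n * iteratedFDeriv ℝ (n + 1) u (x + t • y) (fun _ => y)‖
      ≤ ∫ t in (0:ℝ)..1, (1 - t) ^ n * ((d : ℝ) * ‖y‖) ^ (n + 1) := by
    apply intervalIntegral.norm_integral_le_of_norm_le zero_le_one
    · refine Filter.Eventually.of_forall fun t ht => ?_
      have : 0 ≤ 1 - t := by linarith [ht.2]
      rw [norm_mul, Real.norm_of_nonneg (pow_nonneg this n)]
      exact mul_le_mul_of_nonneg_left (top_bound hu hb _ _) (by positivity)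
    · exact (by fun_prop : Continuous _).intervalIntegrable _ _
  have hJ : ∫ t in (0:ℝ)..1, (1 - t) ^ n = 1 / (n + 1) := by
    rw [intervalIntegral.integral_comp_sub_left (fun t => t ^ n) 1]
    simp
  rw [intervalIntegral.integral_mul_const, hJ] at hI
  rw [abs_mul, abs_of_nonneg (by positivity)]
  calc _ ≤ ((n.factorial : ℝ))⁻¹ * (1 / (n + 1) * ((d : ℝ) * ‖y‖) ^ (n + 1)) :=
        mul_le_mul_of_nonneg_left hI (by positivity)
    _ = _ := by rw [Nat.factorial_succ]; push_cast; field_simp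

lemma jordan_sub_le {X : Type*} [MeasurableSpace X] (μ ν : Measure X) [IsFiniteMeasure μ]
    [IsFiniteMeasure ν] :
    (μ.toSignedMeasure - ν.toSignedMeasure).toJordanDecomposition.posPart ≤ μ ∧
    (μ.toSignedMeasure - ν.toSignedMeasure).toJordanDecomposition.negPart ≤ ν := by
  rw [Measure.toJordanDecomposition_toSignedMeasure_sub]
  exact ⟨Measure.sub_le, Measure.sub_le⟩

lemma sIntegral_sub {X : Type*} [MeasurableSpace X] (μ ν : Measure X) [IsFiniteMeasure μ]
    [IsFiniteMeasure ν] (f : X → ℝ) (hμ : Integrable f μ) (hν : Integrable f ν) :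
    sIntegral (μ.toSignedMeasure - ν.toSignedMeasure) f = ∫ x, f x ∂μ - ∫ x, f x ∂ν := by
  obtain ⟨h1, h2⟩ := jordan_sub_le μ ν
  have h3 := SignedMeasure.toSignedMeasure_toJordanDecomposition
    (μ.toSignedMeasure - ν.toSignedMeasure)
  unfold sIntegral
  set j := (μ.toSignedMeasure - ν.toSignedMeasure).toJordanDecomposition
  have h4 : j.posPart + ν = j.negPart + μ := by
    rw [← Measure.toSignedMeasure_eq_toSignedMeasure_iff, Measure.toSignedMeasure_add,
      Measure.toSignedMeasure_add]
    unfold JordanDecomposition.toSignedMeasure at h3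
    rw [sub_eq_sub_iff_add_eq_add] at h3
    rw [h3, add_comm]
  have h5 : ∫ x, f x ∂(j.posPart + ν) = ∫ x, f x ∂(j.negPart + μ) := by rw [h4]
  rw [integral_add_measure (hμ.mono_measure h1) hν,
    integral_add_measure (hν.mono_measure h2) hμ] at h5
  linarith

lemma map_eq_sub {X Y : Type*} [MeasurableSpace X] [MeasurableSpace Y] (κ : SignedMeasure X)
    (g : X → Y) (hg : Measurable g) :
    κ.map g = (κ.toJordanDecomposition.posPart.map g).toSignedMeasure -
      (κ.toJordanDecomposition.negPart.map g).toSignedMeasure := by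
  ext s hs
  rw [VectorMeasure.map_apply _ hg hs, _root_.sub_apply,
    Measure.toSignedMeasure_apply_measurable hs, Measure.toSignedMeasure_apply_measurable hs,
    SignedMeasure.apply_eq_posPart_real_sub_negPart_real _ (hg hs),
    map_measureReal_apply hg hs, map_measureReal_apply hg hs]

lemma tvNorm_eq {X : Type*} [MeasurableSpace X] (κ : SignedMeasure X) :
    tvNorm κ = κ.toJordanDecomposition.posPart.real Set.univ +
      κ.toJordanDecomposition.negPart.real Set.univ := by
  unfold tvNorm SignedMeasure.totalVariation
  rw [Measure.add_apply, ENNReal.toReal_add (by simp) (by simp)]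
  rfl

lemma integrable_of_ball {d : ℕ} {μ : Measure (EuclideanSpace ℝ (Fin d))} [IsFiniteMeasure μ]
    {r : ℝ} (h : μ (Metric.closedBall 0 r)ᶜ = 0) {f : EuclideanSpace ℝ (Fin d) → ℝ}
    (hf : Continuous f) : Integrable f μ := by
  have h1 : μ.restrict (Metric.closedBall 0 r) = μ :=
    Measure.restrict_eq_self_of_ae_mem (mem_ae_iff.mpr h)
  rw [← h1]
  exact hf.continuousOn.integrableOn_compact (isCompact_closedBall 0 r)

lemma bound_diff {X : Type*} [MeasurableSpace X] (μ ν : Measure X) [IsFiniteMeasure μ]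
    [IsFiniteMeasure ν] (f : X → ℝ) (C : ℝ) (hμ : ∀ᵐ x ∂μ, |f x| ≤ C) (hν : ∀ᵐ x ∂ν, |f x| ≤ C) :
    |∫ x, f x ∂μ - ∫ x, f x ∂ν| ≤ C * (μ.real Set.univ + ν.real Set.univ) := by
  have h1 := norm_integral_le_of_norm_le_const (f := f) hμ
  have h2 := norm_integral_le_of_norm_le_const (f := f) hν
  rw [mul_add]
  exact (abs_sub _ _).trans (add_le_add h1 h2)

lemma prod_eq {d k : ℕ} (f : Fin k → Fin d) (z : Fin d → ℝ) :
    ∏ j, z (f j) = ∏ i, z i ^ (Finset.univ.filter (fun j => f j = i)).card := by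
  rw [← Finset.prod_fiberwise_of_maps_to (s := Finset.univ) (t := Finset.univ) (g := f) (by simp)]
  refine Finset.prod_congr rfl fun i _ => ?_
  rw [Finset.prod_congr rfl (g := fun _ => z i), Finset.prod_const]
  intro j hj
  rw [(Finset.mem_filter.mp hj).2]

lemma sIntegral_taylor {d p : ℕ} (hp : 1 ≤ p)
    (κ : SignedMeasure (EuclideanSpace ℝ (Fin d)))
    (h1 : κ.toJordanDecomposition.posPart
      (Metric.closedBall (0 : EuclideanSpace ℝ (Fin d)) 1)ᶜ = 0)
    (h2 : κ.toJordanDecomposition.negPart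
      (Metric.closedBall (0 : EuclideanSpace ℝ (Fin d)) 1)ᶜ = 0)
    (hmass : κ (Metric.closedBall (0 : EuclideanSpace ℝ (Fin d)) 1) = 1)
    (hvan : ∀ α : Fin d → ℕ, 1 ≤ (∑ i, α i) → (∑ i, α i) ≤ p - 1 →
      sIntegral κ (fun x => ∏ i, x i ^ α i) = 0)
    (ε : ℝ) (u : EuclideanSpace ℝ (Fin d) → ℝ) (x : EuclideanSpace ℝ (Fin d)) :
    sIntegral κ (fun z => ∑ k ∈ Finset.range p, (k.factorial : ℝ)⁻¹ *
      iteratedFDeriv ℝ k u x (fun _ => ε • z)) = u x := by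
  have hm : κ.toJordanDecomposition.posPart.real Set.univ -
      κ.toJordanDecomposition.negPart.real Set.univ = 1 := by
    rw [SignedMeasure.apply_eq_posPart_real_sub_negPart_real _ Metric.isClosed_closedBall.measurableSet]
      at hmass
    rw [← hmass]
    congr 1
    · rw [Measure.real, Measure.real]
      congr 1
      exact (measure_congr (ae_eq_univ.mpr h1)).symm
    · rw [Measure.real, Measure.real]
      congr 1
      exact (measure_congr (ae_eq_univ.mpr h2)).symm
  have hterm : ∀ k ∈ Finset.range p, sIntegral κ (fun z => (k.factorial : ℝ)⁻¹ *
      iteratedFDeriv ℝ k u x (fun _ => ε • z)) = if k = 0 then u x else 0 := by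
    intro k hk
    split_ifs with h0
    · subst h0
      simp only [sIntegral, iteratedFDeriv_zero_apply, integral_const, smul_eq_mul]
      simp only [← sub_mul, hm]
      simp
    · have he : (fun z : EuclideanSpace ℝ (Fin d) => (k.factorial : ℝ)⁻¹ *
          iteratedFDeriv ℝ k u x (fun _ => ε • z)) = fun z => ∑ f : Fin k → Fin d,
            ((k.factorial : ℝ)⁻¹ * ε ^ k *
              iteratedFDeriv ℝ k u x (fun j => EuclideanSpace.single (f j) (1 : ℝ))) *
              ∏ i, z i ^ (Finset.univ.filter (fun j => f j = i)).card := by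
        funext z
        rw [multilin_expand, Finset.mul_sum]
        refine Finset.sum_congr rfl fun f _ => ?_
        rw [← prod_eq f z]
        simp only [PiLp.smul_apply, smul_eq_mul, Finset.prod_mul_distrib, Finset.prod_const,
          Finset.card_univ, Fintype.card_fin]
        ring
      rw [he]
      unfold sIntegral
      rw [integral_finsetSum _ (fun f _ => integrable_of_ball h1 (by fun_prop)),
        integral_finsetSum _ (fun f _ => integrable_of_ball h2 (by fun_prop)),
        ← Finset.sum_sub_distrib]
      refine Finset.sum_eq_zero fun f _ => ?_
      rw [integral_const_mul, integral_const_mul, ← mul_sub]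
      have hs : ∑ i, (Finset.univ.filter (fun j => f j = i)).card = k := by
        rw [← Finset.card_eq_sum_card_fiberwise (by simp)]
        simp
      have := hvan (fun i => (Finset.univ.filter (fun j => f j = i)).card)
        (by rw [hs]; omega) (by rw [hs]; have := Finset.mem_range.mp hk; omega)
      unfold sIntegral at this
      rw [this, mul_zero]
  unfold sIntegral at hterm ⊢
  have hc : ∀ k, Continuous (fun z : EuclideanSpace ℝ (Fin d) => (k.factorial : ℝ)⁻¹ *
      iteratedFDeriv ℝ k u x (fun _ => ε • z)) := by
    intro k
    exact continuous_const.mul ((iteratedFDeriv ℝ k u x).cont.comp (by fun_prop))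
  rw [integral_finsetSum _ (fun k _ => integrable_of_ball h1 (hc k)),
    integral_finsetSum _ (fun k _ => integrable_of_ball h2 (hc k)),
    ← Finset.sum_sub_distrib, Finset.sum_congr rfl hterm]
  simp
  omega

lemma pointwise_bound {d p : ℕ} (hp : 1 ≤ p)
    (κ : SignedMeasure (EuclideanSpace ℝ (Fin d)))
    (h1 : κ.toJordanDecomposition.posPart
      (Metric.closedBall (0 : EuclideanSpace ℝ (Fin d)) 1)ᶜ = 0)
    (h2 : κ.toJordanDecomposition.negPart
      (Metric.closedBall (0 : EuclideanSpace ℝ (Fin d)) 1)ᶜ = 0)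
    (hmass : κ (Metric.closedBall (0 : EuclideanSpace ℝ (Fin d)) 1) = 1)
    (hvan : ∀ α : Fin d → ℕ, 1 ≤ (∑ i, α i) → (∑ i, α i) ≤ p - 1 →
      sIntegral κ (fun x => ∏ i, x i ^ α i) = 0)
    (ε : ℝ) (hε : 0 < ε) {u : EuclideanSpace ℝ (Fin d) → ℝ}
    (hu : ContDiff ℝ (⊤ : ℕ∞) u)
    (hb : ∀ α : Fin d → ℕ, (∑ i, α i) = p → ∀ x, |mderiv α u x| ≤ 1)
    (x : EuclideanSpace ℝ (Fin d)) :
    |sIntegral (κ.map (fun x => ε • x)) (fun y => u (x + y)) - u x| ≤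
      ((d : ℝ) * ε) ^ p / (Nat.factorial p : ℝ) * tvNorm κ := by
  have hmeas : Measurable (fun x : EuclideanSpace ℝ (Fin d) => ε • x) := by fun_prop
  have hcu : Continuous u := hu.continuous
  have hS : sIntegral (κ.map (fun x => ε • x)) (fun y => u (x + y)) =
      sIntegral κ (fun z => u (x + ε • z)) := by
    have hcy : Continuous (fun y => u (x + y)) := by fun_prop
    have hc : Continuous (fun z => u (x + ε • z)) := by fun_prop
    rw [map_eq_sub κ _ hmeas, sIntegral_sub]
    · unfold sIntegral
      rw [integral_map hmeas.aemeasurable hcy.aestronglyMeasurable,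
        integral_map hmeas.aemeasurable hcy.aestronglyMeasurable]
    · rw [integrable_map_measure hcy.aestronglyMeasurable hmeas.aemeasurable]
      exact integrable_of_ball h1 hc
    · rw [integrable_map_measure hcy.aestronglyMeasurable hmeas.aemeasurable]
      exact integrable_of_ball h2 hc
  have hT := sIntegral_taylor hp κ h1 h2 hmass hvan ε u x
  rw [hS]
  refine le_of_eq_of_le (congrArg (fun t => |sIntegral κ (fun z => u (x + ε • z)) - t|) hT.symm) ?_
  have hc : Continuous (fun z => u (x + ε • z)) := by fun_prop
  have hcT : Continuous (fun z : EuclideanSpace ℝ (Fin d) => ∑ k ∈ Finset.range p,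
      (k.factorial : ℝ)⁻¹ * iteratedFDeriv ℝ k u x (fun _ => ε • z)) := by
    refine continuous_finsetSum _ fun k _ => ?_
    exact continuous_const.mul ((iteratedFDeriv ℝ k u x).cont.comp (by fun_prop))
  have hbd : ∀ z ∈ Metric.closedBall (0 : EuclideanSpace ℝ (Fin d)) 1,
      |u (x + ε • z) - ∑ k ∈ Finset.range p,
      (k.factorial : ℝ)⁻¹ * iteratedFDeriv ℝ k u x (fun _ => ε • z)| ≤
      ((d : ℝ) * ε) ^ p / (Nat.factorial p : ℝ) := by
    intro z hz
    refine (taylor_bound hp hu hb x (ε • z)).trans ?_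
    have hz' : ‖z‖ ≤ 1 := by simpa using hz
    have : ‖ε • z‖ ≤ ε := by
      rw [norm_smul, Real.norm_of_nonneg hε.le]
      nlinarith
    gcongr
  have := bound_diff κ.toJordanDecomposition.posPart κ.toJordanDecomposition.negPart
    (fun z => u (x + ε • z) - ∑ k ∈ Finset.range p,
      (k.factorial : ℝ)⁻¹ * iteratedFDeriv ℝ k u x (fun _ => ε • z)) _
    (Filter.Eventually.mono (mem_ae_iff.mpr h1) hbd)
    (Filter.Eventually.mono (mem_ae_iff.mpr h2) hbd)
  rw [integral_sub (integrable_of_ball h1 hc) (integrable_of_ball h1 hcT),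
    integral_sub (integrable_of_ball h2 hc) (integrable_of_ball h2 hcT)] at this
  rw [tvNorm_eq]
  unfold sIntegral
  convert this using 2
  ring

lemma growth {d p : ℕ} (hp : 1 ≤ p) {u : EuclideanSpace ℝ (Fin d) → ℝ}
    (hu : ContDiff ℝ (⊤ : ℕ∞) u)
    (hb : ∀ α : Fin d → ℕ, (∑ i, α i) = p → ∀ x, |mderiv α u x| ≤ 1) :
    ∃ A : ℝ, 0 ≤ A ∧ ∀ y, |u y| ≤ A * (1 + ‖y‖) ^ p := by
  refine ⟨∑ k ∈ Finset.range p, (k.factorial : ℝ)⁻¹ * ‖iteratedFDeriv ℝ k u 0‖ +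
    (d : ℝ) ^ p / p.factorial, by positivity, fun y => ?_⟩
  have h := taylor_bound hp hu hb 0 y
  rw [zero_add] at h
  have h2 : |∑ k ∈ Finset.range p, (k.factorial : ℝ)⁻¹ * iteratedFDeriv ℝ k u 0 (fun _ => y)| ≤
      (∑ k ∈ Finset.range p, (k.factorial : ℝ)⁻¹ * ‖iteratedFDeriv ℝ k u 0‖) * (1 + ‖y‖) ^ p := by
    rw [Finset.sum_mul]
    refine (Finset.abs_sum_le_sum_abs _ _).trans (Finset.sum_le_sum fun k hk => ?_)
    rw [abs_mul, abs_of_nonneg (by positivity), mul_assoc]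
    refine mul_le_mul_of_nonneg_left ?_ (by positivity)
    refine ((iteratedFDeriv ℝ k u 0).le_opNorm _).trans ?_
    refine mul_le_mul_of_nonneg_left ?_ (by positivity)
    simp only [Finset.prod_const, Finset.card_univ, Fintype.card_fin]
    calc ‖y‖ ^ k ≤ (1 + ‖y‖) ^ k := by gcongr; linarith
      _ ≤ _ := pow_le_pow_right₀ (by linarith [norm_nonneg y]) (Finset.mem_range.mp hk).le
  have h3 : ((d : ℝ) * ‖y‖) ^ p / p.factorial ≤ (d : ℝ) ^ p / p.factorial * (1 + ‖y‖) ^ p := by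
    rw [mul_pow, mul_div_right_comm]
    gcongr
    linarith
  rw [add_mul]
  have := abs_sub_abs_le_abs_sub (u y)
    (∑ k ∈ Finset.range p, (k.factorial : ℝ)⁻¹ * iteratedFDeriv ℝ k u 0 (fun _ => y))
  linarith

lemma integrable_moment {d p : ℕ} (hp : 1 ≤ p) {μ : Measure (EuclideanSpace ℝ (Fin d))}
    [IsFiniteMeasure μ] (h : ∫⁻ x, (‖x‖₊ : ℝ≥0∞) ^ p ∂μ < ⊤) :
    Integrable (fun x => (1 + ‖x‖) ^ p) μ := by
  have h0 : Integrable (fun x : EuclideanSpace ℝ (Fin d) => ‖x‖ ^ p) μ := by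
    refine ⟨by fun_prop, ?_⟩
    unfold HasFiniteIntegral
    refine lt_of_le_of_lt (lintegral_mono fun x => ?_) h
    simp [enorm_pow, enorm_eq_nnnorm]
  refine (((integrable_const (1:ℝ)).add h0).const_mul (2 ^ (p - 1))).mono' (by fun_prop)
    (Filter.Eventually.of_forall fun x => ?_)
  rw [Real.norm_of_nonneg (by positivity)]
  simpa using add_pow_le (zero_le_one) (norm_nonneg x) p

lemma integrable_u {d p : ℕ} {μ : Measure (EuclideanSpace ℝ (Fin d))}
    (h : Integrable (fun x => (1 + ‖x‖) ^ p) μ)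
    {u : EuclideanSpace ℝ (Fin d) → ℝ} (hc : Continuous u) {A : ℝ}
    (hA : ∀ y, |u y| ≤ A * (1 + ‖y‖) ^ p) : Integrable u μ :=
  (h.const_mul A).mono' hc.aestronglyMeasurable (Filter.Eventually.of_forall hA)

lemma integrable_prod_u {d p : ℕ} {μ ν : Measure (EuclideanSpace ℝ (Fin d))}
    [IsFiniteMeasure μ] [IsFiniteMeasure ν] {r : ℝ} (hr : 0 ≤ r)
    (hν : ν (Metric.closedBall 0 r)ᶜ = 0)
    (h : Integrable (fun x => (1 + ‖x‖) ^ p) μ)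
    {u : EuclideanSpace ℝ (Fin d) → ℝ} (hc : Continuous u) {A : ℝ} (hA0 : 0 ≤ A)
    (hA : ∀ y, |u y| ≤ A * (1 + ‖y‖) ^ p) :
    Integrable (fun q : EuclideanSpace ℝ (Fin d) × EuclideanSpace ℝ (Fin d) => u (q.1 + q.2))
      (μ.prod ν) := by
  have h' := (h.const_mul (A * (1 + r) ^ p)).comp_fst ν
  refine h'.mono' (by fun_prop) ?_
  have hae : ∀ᵐ q ∂(μ.prod ν), q.2 ∈ Metric.closedBall 0 r :=
    Measure.quasiMeasurePreserving_snd.ae (mem_ae_iff.mpr hν : ∀ᵐ z ∂ν, z ∈ Metric.closedBall _ _)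
  filter_upwards [hae] with q hq
  refine (hA _).trans ?_
  rw [mul_assoc, ← mul_pow]
  have hq' : ‖q.2‖ ≤ r := by simpa using hq
  have := norm_add_le q.1 q.2
  have := norm_nonneg q.1
  gcongr
  nlinarith

lemma final_bound {d p : ℕ} {ε : ℝ} (hε : 0 < ε) (l k : JordanDecomposition (EuclideanSpace ℝ (Fin d)))
    (B T : ℝ) {u : EuclideanSpace ℝ (Fin d) → ℝ} (hcu : Continuous u) {A : ℝ} (hA0 : 0 ≤ A)
    (hA : ∀ y, |u y| ≤ A * (1 + ‖y‖) ^ p)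
    (hpt : ∀ x, |∫ y, u (x + y) ∂k.posPart - ∫ y, u (x + y) ∂k.negPart - u x| ≤ B * T)
    (hk1 : k.posPart (Metric.closedBall 0 ε)ᶜ = 0) (hk2 : k.negPart (Metric.closedBall 0 ε)ᶜ = 0)
    (hm1 : Integrable (fun x => (1 + ‖x‖) ^ p) l.posPart)
    (hm2 : Integrable (fun x => (1 + ‖x‖) ^ p) l.negPart) :
    |sIntegral ((l.posPart.conv k.posPart + l.negPart.conv k.negPart).toSignedMeasure -
      (l.posPart.conv k.negPart + l.negPart.conv k.posPart).toSignedMeasure -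
      (l.posPart.toSignedMeasure - l.negPart.toSignedMeasure)) u| ≤
      B * (l.posPart.real Set.univ + l.negPart.real Set.univ) * T := by
  have i1 := integrable_u hm1 hcu hA
  have i2 := integrable_u hm2 hcu hA
  have j11 := integrable_prod_u hε.le hk1 hm1 hcu hA0 hA
  have j12 := integrable_prod_u hε.le hk2 hm1 hcu hA0 hA
  have j21 := integrable_prod_u hε.le hk1 hm2 hcu hA0 hA
  have j22 := integrable_prod_u hε.le hk2 hm2 hcu hA0 hA
  have conv_of : ∀ {μ ν : Measure (EuclideanSpace ℝ (Fin d))},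
      Integrable (fun q : EuclideanSpace ℝ (Fin d) × EuclideanSpace ℝ (Fin d) => u (q.1 + q.2))
      (μ.prod ν) → Integrable u (μ.conv ν) := by
    intro μ ν h
    unfold Measure.conv
    rw [integrable_map_measure hcu.aestronglyMeasurable (by fun_prop)]
    exact h
  have c11 := conv_of j11
  have c12 := conv_of j12
  have c21 := conv_of j21
  have c22 := conv_of j22
  have e : (l.posPart.conv k.posPart + l.negPart.conv k.negPart).toSignedMeasure -
      (l.posPart.conv k.negPart + l.negPart.conv k.posPart).toSignedMeasure -
      (l.posPart.toSignedMeasure - l.negPart.toSignedMeasure) =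
      (l.posPart.conv k.posPart + l.negPart.conv k.negPart + l.negPart).toSignedMeasure -
      (l.posPart.conv k.negPart + l.negPart.conv k.posPart + l.posPart).toSignedMeasure := by
    rw [Measure.toSignedMeasure_add _ l.negPart, Measure.toSignedMeasure_add _ l.posPart]
    abel
  rw [e, sIntegral_sub _ _ _ ((c11.add_measure c22).add_measure i2)
    ((c12.add_measure c21).add_measure i1),
    integral_add_measure (c11.add_measure c22) i2, integral_add_measure c11 c22,
    integral_add_measure (c12.add_measure c21) i1, integral_add_measure c12 c21,
    integral_conv c11, integral_conv c12, integral_conv c21, integral_conv c22]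
  have hfin := bound_diff l.posPart l.negPart _ _ (Filter.Eventually.of_forall hpt)
    (Filter.Eventually.of_forall hpt)
  have I11 := j11.integral_prod_left
  have I12 := j12.integral_prod_left
  have I21 := j21.integral_prod_left
  have I22 := j22.integral_prod_left
  have S : ∀ (μ : Measure (EuclideanSpace ℝ (Fin d))) (f g h : EuclideanSpace ℝ (Fin d) → ℝ),
      Integrable f μ → Integrable g μ → Integrable h μ →
      ∫ x, (f x - g x - h x) ∂μ = ∫ x, f x ∂μ - ∫ x, g x ∂μ - ∫ x, h x ∂μ := by
    intro μ f g h hf hg hh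
    have := integral_sub (hf.sub hg) hh
    simp only [Pi.sub_apply] at this
    rw [this, integral_sub hf hg]
  have S1 := S _ _ _ _ I11 I12 i1
  have S2 := S _ _ _ _ I21 I22 i2
  dsimp only at S1 S2
  rw [S1, S2] at hfin
  refine le_of_eq_of_le ?_ (hfin.trans_eq ?_)
  · congr 1
    ring
  · ring

/-- **Proposition 3.1.** Let `κ` be a finite signed measure supported on the closed unit ball
with `κ(B_1) = 1` and vanishing mixed moments of orders `1 ≤ |α| ≤ p-1`, and let `κ_ε` be its
image under `x ↦ ε x`. Then for every finite signed measure `λ` with finite `p`-th absolute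
moment, `‖λ ∗ κ_ε - λ‖_{ζ_p} ≤ ((dε)^p / p!) ‖λ‖_TV ‖κ‖_TV`. -/
theorem zolotarevSemi_conv_sub_le (d p : ℕ) (hp : 1 ≤ p)
    (κ : SignedMeasure (EuclideanSpace ℝ (Fin d)))
    (hsupp : κ.totalVariation (Metric.closedBall (0 : EuclideanSpace ℝ (Fin d)) 1)ᶜ = 0)
    (hmass : κ (Metric.closedBall (0 : EuclideanSpace ℝ (Fin d)) 1) = 1)
    (hvan : ∀ α : Fin d → ℕ, 1 ≤ (∑ i, α i) → (∑ i, α i) ≤ p - 1 →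
      sIntegral κ (fun x => ∏ i, x i ^ α i) = 0)
    (ε : ℝ) (hε : 0 < ε)
    (lam : SignedMeasure (EuclideanSpace ℝ (Fin d)))
    (hlam : ∫⁻ x, (‖x‖₊ : ℝ≥0∞) ^ p ∂lam.totalVariation < ⊤) :
    zolotarevSemi p (sConv lam (κ.map (fun x => ε • x)) - lam) ≤
      ((d : ℝ) * ε) ^ p / (Nat.factorial p : ℝ) * tvNorm lam * tvNorm κ := by

  have hC : 0 ≤ ((d : ℝ) * ε) ^ p / (Nat.factorial p : ℝ) * tvNorm κ :=
    mul_nonneg (by positivity) ENNReal.toReal_nonneg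
  have hC' : 0 ≤ ((d : ℝ) * ε) ^ p / (Nat.factorial p : ℝ) * tvNorm lam * tvNorm κ :=
    mul_nonneg (mul_nonneg (by positivity) ENNReal.toReal_nonneg) ENNReal.toReal_nonneg
  unfold zolotarevSemi
  refine Real.sSup_le ?_ hC'
  rintro _ ⟨u, hu, hb, rfl⟩
  have hcu : Continuous u := hu.continuous
  have h12 : κ.toJordanDecomposition.posPart
      (Metric.closedBall (0 : EuclideanSpace ℝ (Fin d)) 1)ᶜ = 0 ∧
      κ.toJordanDecomposition.negPart
      (Metric.closedBall (0 : EuclideanSpace ℝ (Fin d)) 1)ᶜ = 0 := by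
    unfold SignedMeasure.totalVariation at hsupp
    simpa using hsupp
  obtain ⟨h1, h2⟩ := h12
  have hpt := pointwise_bound hp κ h1 h2 hmass hvan ε hε hu hb
  obtain ⟨A, hA0, hA⟩ := growth hp hu hb
  have hmeas : Measurable (fun x : EuclideanSpace ℝ (Fin d) => ε • x) := by fun_prop
  have hsub : (fun x : EuclideanSpace ℝ (Fin d) => ε • x) ⁻¹' (Metric.closedBall 0 ε)ᶜ ⊆
      (Metric.closedBall 0 1)ᶜ := by
    intro x hx hx1
    apply hx
    simp only [Metric.mem_closedBall, dist_zero_right, norm_smul, Real.norm_of_nonneg hε.le] at *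
    nlinarith
  have hball : MeasurableSet (Metric.closedBall (0 : EuclideanSpace ℝ (Fin d)) ε)ᶜ :=
    Metric.isClosed_closedBall.measurableSet.compl
  have hk : (SignedMeasure.toJordanDecomposition (κ.map (fun x => ε • x))).posPart (Metric.closedBall 0 ε)ᶜ = 0 ∧
      (SignedMeasure.toJordanDecomposition (κ.map (fun x => ε • x))).negPart (Metric.closedBall 0 ε)ᶜ = 0 := by
    rw [map_eq_sub κ _ hmeas]
    obtain ⟨g1, g2⟩ := jordan_sub_le
      (κ.toJordanDecomposition.posPart.map (fun x : EuclideanSpace ℝ (Fin d) => ε • x))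
      (κ.toJordanDecomposition.negPart.map (fun x : EuclideanSpace ℝ (Fin d) => ε • x))
    refine ⟨le_antisymm ((g1 _).trans ?_) (zero_le), le_antisymm ((g2 _).trans ?_) (zero_le)⟩
    · rw [Measure.map_apply hmeas hball]
      exact (measure_mono hsub).trans h1.le
    · rw [Measure.map_apply hmeas hball]
      exact (measure_mono hsub).trans h2.le
  obtain ⟨hk1, hk2⟩ := hk
  have hl : (∫⁻ x, (‖x‖₊ : ℝ≥0∞) ^ p ∂lam.toJordanDecomposition.posPart < ⊤) ∧
      (∫⁻ x, (‖x‖₊ : ℝ≥0∞) ^ p ∂lam.toJordanDecomposition.negPart < ⊤) := by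
    unfold SignedMeasure.totalVariation at hlam
    rw [lintegral_add_measure] at hlam
    exact ENNReal.add_lt_top.mp hlam
  have hm1 := integrable_moment hp hl.1
  have hm2 := integrable_moment hp hl.2
  have hdec : sConv lam (κ.map (fun x => ε • x)) - lam = sConv lam (κ.map (fun x => ε • x)) -
      (lam.toJordanDecomposition.posPart.toSignedMeasure -
        lam.toJordanDecomposition.negPart.toSignedMeasure) := by
    congr 1
    exact (SignedMeasure.toSignedMeasure_toJordanDecomposition lam).symm
  rw [hdec, tvNorm_eq lam]
  unfold sConv
  unfold sIntegral at hpt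
  exact final_bound hε _ _ _ _ hcu hA0 hA hpt hk1 hk2 hm1 hm2
end
end

section
/- For every integer p ≥ 1 and dimension d ≥ 1 there exists a rotationally invariant finite signed Borel measure κ on ℝ^d, supported on the closed unit ball B_1, absolutely continuous with density w, such that: κ(B_1) = 1; ∫ x^α dκ(x) = 0 for all multi-indices α with 1 ≤ |α| ≤ p−1; |w(x)| ≤ (1/ω_d) · p^{d+1} · 8^p for all x ∈ B_1; and ‖κ‖_{TV} ≤ p · 2^{3p−1}. -/
open MeasureTheory
open scoped RealInnerProductSpace ENNReal NNReal

noncomputable section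


lemma jordan_withDensity {X : Type*} [MeasurableSpace X] (μ : Measure X) (w : X → ℝ)
    (hm : Measurable w) (hw : Integrable w μ) :
    ((SignedMeasure.toJordanDecomposition (μ.withDensityᵥ w)).posPart
      = μ.withDensity (fun x => ENNReal.ofReal (w x))) ∧
    ((SignedMeasure.toJordanDecomposition (μ.withDensityᵥ w)).negPart
      = μ.withDensity (fun x => ENNReal.ofReal (-w x))) := by
  have h1 : IsFiniteMeasure (μ.withDensity (fun x => ENNReal.ofReal (w x))) :=
    isFiniteMeasure_withDensity_ofReal hw.2
  have h2 : IsFiniteMeasure (μ.withDensity (fun x => ENNReal.ofReal (-w x))) :=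
    isFiniteMeasure_withDensity_ofReal hw.neg.2
  have key : (SignedMeasure.toJordanDecomposition (μ.withDensityᵥ w)) =
      { posPart := μ.withDensity (fun x => ENNReal.ofReal (w x))
        negPart := μ.withDensity (fun x => ENNReal.ofReal (-w x))
        posPart_finite := h1
        negPart_finite := h2
        mutuallySingular := withDensity_ofReal_mutuallySingular hm } :=
    SignedMeasure.toJordanDecomposition_eq
      (withDensityᵥ_eq_withDensity_pos_part_sub_withDensity_neg_part hw)
  rw [key]
  exact ⟨rfl, rfl⟩

lemma sIntegral_withDensity {X : Type*} [MeasurableSpace X] (μ : Measure X) (w f : X → ℝ)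
    (hm : Measurable w) (hw : Integrable w μ) (hf : Measurable f)
    (hwf : Integrable (fun x => w x * f x) μ) :
    sIntegral (μ.withDensityᵥ w) f = ∫ x, w x * f x ∂μ := by
  obtain ⟨h1, h2⟩ := jordan_withDensity μ w hm hw
  unfold sIntegral
  rw [h1, h2, integral_withDensity_eq_integral_toReal_smul (by fun_prop) (by simp),
    integral_withDensity_eq_integral_toReal_smul (by fun_prop) (by simp), ← integral_sub]
  · refine integral_congr_ae (.of_forall fun x => ?_)
    simp only [ENNReal.toReal_ofReal_eq_iff, smul_eq_mul, ENNReal.toReal_ofReal']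
    rw [← sub_mul, max_zero_sub_max_neg_zero_eq_self]
  · refine hwf.mono (Measurable.aestronglyMeasurable (by fun_prop)) (.of_forall fun x => ?_)
    simp only [smul_eq_mul, ENNReal.toReal_ofReal', norm_mul, Real.norm_eq_abs]
    refine mul_le_mul_of_nonneg_right ?_ (abs_nonneg _)
    rw [abs_of_nonneg (le_max_right _ _)]
    exact max_le (le_abs_self _) (abs_nonneg _)
  · refine hwf.mono (Measurable.aestronglyMeasurable (by fun_prop)) (.of_forall fun x => ?_)
    simp only [smul_eq_mul, ENNReal.toReal_ofReal', norm_mul, Real.norm_eq_abs]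
    refine mul_le_mul_of_nonneg_right ?_ (abs_nonneg _)
    rw [abs_of_nonneg (le_max_right _ _)]
    exact max_le (neg_le_abs _) (abs_nonneg _)

lemma tvNorm_withDensity {X : Type*} [MeasurableSpace X] (μ : Measure X) (w : X → ℝ)
    (hm : Measurable w) (hw : Integrable w μ) :
    tvNorm (μ.withDensityᵥ w) = ∫ x, |w x| ∂μ := by
  obtain ⟨h1, h2⟩ := jordan_withDensity μ w hm hw
  unfold tvNorm SignedMeasure.totalVariation
  rw [h1, h2, integral_eq_lintegral_of_nonneg_ae (.of_forall fun x => abs_nonneg _)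
    (Measurable.aestronglyMeasurable (by fun_prop))]
  simp only [Measure.coe_add, Pi.add_apply, withDensity_apply _ MeasurableSet.univ,
    Measure.restrict_univ]
  rw [← lintegral_add_left (by fun_prop)]
  congr 1
  refine lintegral_congr fun x => ?_
  rcases le_total 0 (w x) with h | h
  · rw [abs_of_nonneg h, ENNReal.ofReal_of_nonpos (p := -w x) (by linarith), add_zero]
  · rw [abs_of_nonpos h, ENNReal.ofReal_of_nonpos h, zero_add]

/-- Lagrange coefficients. -/
def ck (p k : ℕ) : ℝ := -(-1) ^ p * ((-1) ^ (p - (k + 1)) * (p.choose (k + 1) : ℝ))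

lemma abs_ck (p k : ℕ) : |ck p k| = p.choose (k + 1) := by
  simp [ck, abs_mul, abs_pow]

lemma sum_abs_ck (p : ℕ) : ∑ k ∈ Finset.range p, |ck p k| ≤ 2 ^ p := by
  have h := Nat.sum_range_choose p
  rw [Finset.sum_range_succ'] at h
  simp only [abs_ck]
  rw [← Nat.cast_sum]
  calc _ ≤ ((2 ^ p : ℕ) : ℝ) := by gcongr; omega
    _ = 2 ^ p := by push_cast; rfl

lemma sum_ck (p j : ℕ) (h : j < p) :
    ∑ k ∈ Finset.range p, ck p k * ((k : ℝ) + 1) ^ j = 0 ^ j := by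
  have h0 := congrFun (fwdDiff_iter_pow_eq_zero_of_lt (R := ℝ) h) 0
  rw [fwdDiff_iter_eq_sum_shift, Finset.sum_range_succ'] at h0
  simp at h0
  simp only [ck, mul_assoc]
  rw [← Finset.mul_sum]
  simp only [mul_assoc] at h0
  rw [eq_neg_of_add_eq_zero_left h0]
  have : ((-1 : ℝ) ^ p) * (-1) ^ p = 1 := by rw [← mul_pow]; simp
  linear_combination (0 ^ j) * this

abbrev E (d : ℕ) := EuclideanSpace ℝ (Fin d)

/-- volume of the unit ball -/
def om (d : ℕ) : ℝ := (volume (Metric.closedBall (0 : E d) 1)).toReal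

lemma om_pos (d : ℕ) : 0 < om d :=
  ENNReal.toReal_pos (Metric.measure_closedBall_pos _ _ one_pos).ne' measure_closedBall_lt_top.ne

/-- radii -/
def rk (p k : ℕ) : ℝ := ((k : ℝ) + 1) / p

/-- the kernel -/
def kern (d p : ℕ) (x : E d) : ℝ :=
  ∑ k ∈ Finset.range p, (ck p k / (om d * rk p k ^ d)) *
    (Metric.closedBall (0 : E d) (rk p k)).indicator (fun _ => (1 : ℝ)) x

lemma rk_pos {p : ℕ} (hp : 1 ≤ p) (k : ℕ) : 0 < rk p k := by
  unfold rk
  have : (0 : ℝ) < p := by exact_mod_cast hp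
  positivity

lemma rk_le {p k : ℕ} (h : k < p) : rk p k ≤ 1 := by
  unfold rk
  have : (0 : ℝ) < p := by exact_mod_cast (by omega : 0 < p)
  rw [div_le_one this]
  exact_mod_cast h

lemma kern_meas (d p : ℕ) : Measurable (kern d p) := by
  unfold kern
  refine Finset.measurable_fun_sum _ fun k _ => ?_
  exact (measurable_const.indicator Metric.isClosed_closedBall.measurableSet).const_mul _

lemma term_int (d : ℕ) (r c : ℝ) (f : E d → ℝ) (hf : Continuous f) :
    Integrable (fun x => c * (Metric.closedBall (0 : E d) r).indicator (fun _ => (1 : ℝ)) x * f x)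
      volume := by
  have h : (fun x => c * (Metric.closedBall (0 : E d) r).indicator (fun _ => (1 : ℝ)) x * f x)
    = fun x => c * (Metric.closedBall (0 : E d) r).indicator f x := by
    ext x
    by_cases hx : x ∈ Metric.closedBall (0 : E d) r <;> simp [hx]
  rw [h]
  refine Integrable.const_mul ?_ _
  rw [integrable_indicator_iff Metric.isClosed_closedBall.measurableSet]
  exact hf.continuousOn.integrableOn_compact (isCompact_closedBall _ _)

lemma kern_mul_int (d p : ℕ) (f : E d → ℝ) (hf : Continuous f) :
    Integrable (fun x => kern d p x * f x) volume := by
  simp only [kern, Finset.sum_mul]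
  exact integrable_finsetSum _ fun k _ => term_int d _ _ f hf

lemma kern_int (d p : ℕ) : Integrable (kern d p) volume := by
  simpa using kern_mul_int d p (fun _ => 1) continuous_const

lemma ball_scale (d : ℕ) (f : E d → ℝ) (n : ℕ) (r : ℝ) (hr : 0 < r)
    (hh : ∀ x, f (r • x) = r ^ n * f x) :
    ∫ x in Metric.closedBall (0 : E d) r, f x
      = r ^ d * r ^ n * ∫ x in Metric.closedBall (0 : E d) 1, f x := by
  have h := Measure.setIntegral_comp_smul_of_pos (volume : Measure (E d)) f
    (Metric.closedBall (0 : E d) 1) hr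
  rw [smul_closedBall _ _ zero_le_one] at h
  simp only [hh, smul_zero, Real.norm_eq_abs, abs_of_pos hr, mul_one, finrank_euclideanSpace,
    Fintype.card_fin, smul_eq_mul] at h
  rw [integral_const_mul] at h
  rw [mul_assoc, h, mul_inv_cancel_left₀ (by positivity)]

lemma kern_moment (d p : ℕ) (hp : 1 ≤ p) (f : E d → ℝ) (hf : Continuous f) (n : ℕ) (hn : n < p)
    (hh : ∀ r : ℝ, ∀ x, f (r • x) = r ^ n * f x) :
    ∫ x, kern d p x * f x = 0 ^ n * ((∫ x in Metric.closedBall (0 : E d) 1, f x) / om d) := by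
  simp only [kern, Finset.sum_mul]
  rw [integral_finsetSum _ fun k _ => term_int d _ _ f hf]
  have hp' : (p : ℝ) ≠ 0 := by positivity
  have h : ∀ k ∈ Finset.range p,
      ∫ x, (ck p k / (om d * rk p k ^ d)) *
        (Metric.closedBall (0 : E d) (rk p k)).indicator (fun _ => (1 : ℝ)) x * f x
      = ck p k * ((k : ℝ) + 1) ^ n *
        (((∫ x in Metric.closedBall (0 : E d) 1, f x) / om d) / p ^ n) := by
    intro k _
    have hr := rk_pos hp k
    have ho := om_pos d
    have e : ∀ x, (ck p k / (om d * rk p k ^ d)) *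
        (Metric.closedBall (0 : E d) (rk p k)).indicator (fun _ => (1 : ℝ)) x * f x
      = (ck p k / (om d * rk p k ^ d)) *
        (Metric.closedBall (0 : E d) (rk p k)).indicator f x := by
      intro x
      by_cases hx : x ∈ Metric.closedBall (0 : E d) (rk p k) <;> simp [hx]
    simp only [e]
    rw [integral_const_mul, integral_indicator Metric.isClosed_closedBall.measurableSet,
      ball_scale d f n _ hr (hh _)]
    have : rk p k ^ n = ((k : ℝ) + 1) ^ n / p ^ n := by rw [rk, div_pow]
    rw [this]
    field_simp
  rw [Finset.sum_congr rfl h, ← Finset.sum_mul, sum_ck p n hn]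
  rcases Nat.eq_zero_or_pos n with rfl | h0
  · simp
  · simp [h0.ne']

lemma kern_bound (d p : ℕ) (hp : 1 ≤ p) (x : E d) :
    |kern d p x| ≤ 1 / om d * p ^ d * 2 ^ p := by
  have ho := om_pos d
  have hp' : (0 : ℝ) < p := by positivity
  calc |kern d p x| ≤ ∑ k ∈ Finset.range p, |(ck p k / (om d * rk p k ^ d)) *
        (Metric.closedBall (0 : E d) (rk p k)).indicator (fun _ => (1 : ℝ)) x| :=
        Finset.abs_sum_le_sum_abs _ _
    _ ≤ ∑ k ∈ Finset.range p, |ck p k| * (1 / om d * p ^ d) := by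
        refine Finset.sum_le_sum fun k _ => ?_
        have hr := rk_pos hp k
        have h1 : |(Metric.closedBall (0 : E d) (rk p k)).indicator (fun _ => (1 : ℝ)) x| ≤ 1 := by
          by_cases hx : x ∈ Metric.closedBall (0 : E d) (rk p k) <;> simp [hx]
        rw [abs_mul, abs_div, abs_of_pos (a := om d * rk p k ^ d) (by positivity)]
        calc _ ≤ |ck p k| / (om d * rk p k ^ d) * 1 := by gcongr
          _ = |ck p k| * (1 / om d * (1 / rk p k) ^ d) := by rw [one_div_pow]; field_simp
          _ ≤ _ := by
            gcongr
            rw [rk, one_div_div]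
            exact div_le_self hp'.le (by linarith [(Nat.cast_nonneg k : (0 : ℝ) ≤ k)])
    _ = (1 / om d * p ^ d) * ∑ k ∈ Finset.range p, |ck p k| := by
        rw [← Finset.sum_mul, mul_comm]
    _ ≤ _ := by gcongr; exact sum_abs_ck p

lemma kern_tv (d p : ℕ) (hp : 1 ≤ p) : ∫ x, |kern d p x| ≤ 2 ^ p := by
  have ho := om_pos d
  have hi : ∀ k, Integrable (fun x => |ck p k| / (om d * rk p k ^ d) *
        (Metric.closedBall (0 : E d) (rk p k)).indicator (fun _ => (1 : ℝ)) x) volume := by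
    intro k
    simpa using term_int d (rk p k) (|ck p k| / (om d * rk p k ^ d)) (fun _ => 1) continuous_const
  calc ∫ x, |kern d p x| ≤ ∫ x, ∑ k ∈ Finset.range p, |ck p k| / (om d * rk p k ^ d) *
        (Metric.closedBall (0 : E d) (rk p k)).indicator (fun _ => (1 : ℝ)) x := by
        refine integral_mono (kern_int d p).abs (integrable_finsetSum _ fun k _ => hi k)
          fun x => ?_
        refine (Finset.abs_sum_le_sum_abs _ _).trans (Finset.sum_le_sum fun k _ => ?_)
        have hr := rk_pos hp k
        rw [abs_mul, abs_div, abs_of_pos (a := om d * rk p k ^ d) (by positivity)]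
        apply le_of_eq
        congr 1
        by_cases hx : x ∈ Metric.closedBall (0 : E d) (rk p k) <;> simp [hx]
    _ = ∑ k ∈ Finset.range p, |ck p k| := by
        rw [integral_finsetSum _ fun k _ => hi k]
        refine Finset.sum_congr rfl fun k _ => ?_
        have hr := rk_pos hp k
        rw [integral_const_mul, integral_indicator Metric.isClosed_closedBall.measurableSet,
          ball_scale d (fun _ => 1) 0 _ hr (by simp)]
        have : ∫ x in Metric.closedBall (0 : E d) 1, (1 : ℝ) = om d := by
          simp [om, Measure.real]
        rw [this]
        field_simp
    _ ≤ _ := sum_abs_ck p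

lemma kern_supp (d p : ℕ) (x : E d) (hx : x ∉ Metric.closedBall (0 : E d) 1) :
    kern d p x = 0 := by
  unfold kern
  refine Finset.sum_eq_zero fun k hk => ?_
  rw [Set.indicator_of_notMem, mul_zero]
  exact fun h => hx (Metric.closedBall_subset_closedBall (rk_le (Finset.mem_range.1 hk)) h)

lemma kern_rot (d p : ℕ) (T : E d ≃ₗᵢ[ℝ] E d) (x : E d) : kern d p (T x) = kern d p x := by
  simp [kern, Set.indicator]

/-- **Lemma 3.2.** For every integer `p ≥ 1` and dimension `d ≥ 1` there exists a rotationally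
invariant finite signed measure `κ` on `ℝ^d`, supported on the closed unit ball and absolutely
continuous with density `w`, such that `κ(B_1) = 1`, all mixed moments of orders
`1 ≤ |α| ≤ p-1` vanish, `|w(x)| ≤ (1/ω_d) p^{d+1} 8^p` on `B_1`, and `‖κ‖_TV ≤ p 2^{3p-1}`. -/
theorem exists_smoothing_kernel (d p : ℕ) (hd : 1 ≤ d) (hp : 1 ≤ p) :
    ∃ w : EuclideanSpace ℝ (Fin d) → ℝ, Integrable w volume ∧
      (∀ T : EuclideanSpace ℝ (Fin d) ≃ₗᵢ[ℝ] EuclideanSpace ℝ (Fin d),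
        (volume.withDensityᵥ w).map ⇑T = volume.withDensityᵥ w) ∧
      (∀ x : EuclideanSpace ℝ (Fin d), x ∉ Metric.closedBall (0 : EuclideanSpace ℝ (Fin d)) 1 →
        w x = 0) ∧
      (volume.withDensityᵥ w) (Metric.closedBall (0 : EuclideanSpace ℝ (Fin d)) 1) = 1 ∧
      (∀ α : Fin d → ℕ, 1 ≤ (∑ i, α i) → (∑ i, α i) ≤ p - 1 →
        sIntegral (volume.withDensityᵥ w) (fun x => ∏ i, x i ^ α i) = 0) ∧
      (∀ x ∈ Metric.closedBall (0 : EuclideanSpace ℝ (Fin d)) 1,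
        |w x| ≤ (1 / (volume (Metric.closedBall (0 : EuclideanSpace ℝ (Fin d)) 1)).toReal) *
          (p : ℝ) ^ (d + 1) * 8 ^ p) ∧
      tvNorm (volume.withDensityᵥ w) ≤ (p : ℝ) * 2 ^ (3 * p - 1) := by
  have hom : (volume (Metric.closedBall (0 : EuclideanSpace ℝ (Fin d)) 1)).toReal = om d := rfl
  have hint := kern_int d p
  have hp1 : (1 : ℝ) ≤ p := by exact_mod_cast hp
  refine ⟨kern d p, hint, ?_, kern_supp d p, ?_, ?_, ?_, ?_⟩
  · intro T
    ext s hs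
    have hT : Measurable T := T.continuous.measurable
    rw [VectorMeasure.map_apply _ hT hs, withDensityᵥ_apply hint hs,
      withDensityᵥ_apply hint (hT hs)]
    have := T.measurePreserving.setIntegral_preimage_emb
      T.toHomeomorph.measurableEmbedding (kern d p) s
    simpa only [kern_rot] using this
  · rw [withDensityᵥ_apply hint Metric.isClosed_closedBall.measurableSet,
      setIntegral_eq_integral_of_forall_compl_eq_zero (kern_supp d p)]
    have h := kern_moment d p hp (fun _ => 1) continuous_const 0 (by omega) (by simp)
    have h1 : ∫ x in Metric.closedBall (0 : E d) 1, (1 : ℝ) = om d := by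
      simp [om, Measure.real]
    rw [h1, div_self (om_pos d).ne'] at h
    simpa using h
  · intro α h1 h2
    have hc : Continuous (fun x : E d => ∏ i, x i ^ α i) := by fun_prop
    rw [sIntegral_withDensity _ _ _ (kern_meas d p) hint hc.measurable (kern_mul_int d p _ hc),
      kern_moment d p hp _ hc (∑ i, α i) (by omega), zero_pow (by omega), zero_mul]
    intro r x
    simp [mul_pow, Finset.prod_mul_distrib, Finset.prod_pow_eq_pow_sum]
  · intro x _
    rw [hom]
    refine (kern_bound d p hp x).trans ?_
    have := om_pos d
    gcongr
    · omega
    · norm_num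
  · rw [tvNorm_withDensity _ _ (kern_meas d p) hint]
    refine (kern_tv d p hp).trans ?_
    calc (2 : ℝ) ^ p ≤ 2 ^ (3 * p - 1) := by
          gcongr
          · norm_num
          · omega
      _ ≤ _ := le_mul_of_one_le_left (by positivity) hp1
end
end

section
/- For every integer p ≥ 2 there exists a finite signed Borel measure κ_0 supported on the interval (0,1) ⊂ ℝ such that κ_0((0,1)) = 1, ∫_0^1 r^k dκ_0(r) = 0 for all integers k = 1, …, p−1, and ‖κ_0‖_{TV} ≤ p · 2^{3p−1}. -/
open MeasureTheory
open scoped RealInnerProductSpace ENNReal NNReal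

noncomputable section


def kerPt (p j : ℕ) : ℝ := (j : ℝ) / (p + 1)

def kerM (p : ℕ) (u : Finset ℕ) : Measure ℝ :=
  ∑ j ∈ u, (p.choose j : ℝ≥0∞) • Measure.dirac (kerPt p j)

lemma kerPt_inj (p i j : ℕ) (h : kerPt p i = kerPt p j) : i = j := by
  unfold kerPt at h
  have : (p : ℝ) + 1 ≠ 0 := by positivity
  field_simp at h
  exact_mod_cast h

lemma kerPt_mem (p j : ℕ) (h : j ∈ Finset.Icc 1 p) : kerPt p j ∈ Set.Ioo (0 : ℝ) 1 := by
  rw [Finset.mem_Icc] at h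
  have h1 : (1 : ℝ) ≤ j := by exact_mod_cast h.1
  have h2 : (j : ℝ) ≤ p := by exact_mod_cast h.2
  unfold kerPt
  constructor
  · positivity
  · rw [div_lt_one (by positivity)]; linarith

lemma kerM_zero (p : ℕ) (u : Finset ℕ) (A : Set ℝ) (hA : MeasurableSet A)
    (h : ∀ j ∈ u, kerPt p j ∉ A) : kerM p u A = 0 := by
  unfold kerM
  rw [Measure.finsetSum_apply]
  refine Finset.sum_eq_zero fun j hj => ?_
  simp [Measure.dirac_apply' _ hA, h j hj]

lemma kerM_full (p : ℕ) (u : Finset ℕ) (A : Set ℝ) (hA : MeasurableSet A)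
    (h : ∀ j ∈ u, kerPt p j ∈ A) : kerM p u A = ((∑ j ∈ u, p.choose j : ℕ) : ℝ≥0∞) := by
  unfold kerM
  rw [Measure.finsetSum_apply, Nat.cast_sum]
  refine Finset.sum_congr rfl fun j hj => ?_
  simp [Measure.dirac_apply' _ hA, h j hj]

instance kerM_fin (p : ℕ) (u : Finset ℕ) : IsFiniteMeasure (kerM p u) := by
  constructor
  rw [kerM_full p u _ MeasurableSet.univ (by simp)]
  exact ENNReal.natCast_lt_top _

lemma kerM_sing (p : ℕ) (u v : Finset ℕ) (h : Disjoint u v) :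
    Measure.MutuallySingular (kerM p u) (kerM p v) := by
  have hm : MeasurableSet (↑(v.image (kerPt p)) : Set ℝ) := Finset.measurableSet _
  refine ⟨_, hm, kerM_zero _ _ _ hm ?_, kerM_zero _ _ _ hm.compl ?_⟩
  · intro j hj hj'
    simp only [Finset.coe_image, Set.mem_image, Finset.mem_coe] at hj'
    obtain ⟨i, hi, hij⟩ := hj'
    rw [kerPt_inj _ _ _ hij] at hi
    exact Finset.disjoint_left.1 h hj hi
  · intro j hj hj'
    exact hj' (by simpa using ⟨j, hj, rfl⟩)

lemma kerM_int (p : ℕ) (u : Finset ℕ) (f : ℝ → ℝ) :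
    ∫ x, f x ∂(kerM p u) = ∑ j ∈ u, (p.choose j : ℝ) * f (kerPt p j) := by
  unfold kerM
  rw [integral_finsetSum_measure]
  · simp
  · intro j _
    exact (integrable_dirac (by simp)).smul_measure (by simp)

lemma ker_alt (p k : ℕ) (h : k < p) :
    ∑ j ∈ Finset.Icc 1 p, (-1 : ℝ) ^ (j + 1) * ((p.choose j : ℝ) * (j : ℝ) ^ k) = 0 ^ k := by
  have h1 := congrFun (fwdDiff_iter_pow_eq_zero_of_lt (R := ℝ) h) 0
  rw [fwdDiff_iter_eq_sum_shift] at h1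
  have h2 : ∑ j ∈ Finset.range (p + 1), (-1 : ℝ) ^ (j + 1) * ((p.choose j : ℝ) * (j : ℝ) ^ k)
      = 0 := by
    have := congrArg (fun z => (-1 : ℝ) ^ (p + 1) * z) h1
    simp only [Pi.zero_apply, mul_zero, Finset.mul_sum] at this
    rw [← this]
    refine Finset.sum_congr rfl fun j hj => ?_
    have hj' : j ≤ p := by simpa [Nat.lt_succ_iff] using hj
    obtain ⟨d, rfl⟩ := Nat.exists_eq_add_of_le hj'
    have hd : (-1 : ℝ) ^ d * (-1) ^ d = 1 := by rw [← mul_pow]; simp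
    simp only [Nat.add_sub_cancel_left, zsmul_eq_mul, zero_add, nsmul_eq_mul, mul_one]
    push_cast
    rw [show (-1 : ℝ) ^ (j + d + 1) = (-1) ^ (j + 1) * (-1) ^ d by ring]
    linear_combination (-(-1 : ℝ) ^ (j + 1) * ((j + d).choose j : ℝ) * (j : ℝ) ^ k) * hd
  rw [Finset.range_eq_Ico, Finset.sum_eq_sum_Ico_succ_bot (by omega)] at h2
  simp only [zero_add, Nat.choose_zero_right, Nat.cast_one, Nat.cast_zero] at h2
  rw [show Finset.Icc 1 p = Finset.Ico 1 (p + 1) from rfl]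
  linarith

lemma ker_diff (p : ℕ) (g : ℕ → ℝ) :
    ∑ j ∈ (Finset.Icc 1 p).filter Odd, g j - ∑ j ∈ (Finset.Icc 1 p).filter (fun j => ¬ Odd j), g j
      = ∑ j ∈ Finset.Icc 1 p, (-1 : ℝ) ^ (j + 1) * g j := by
  rw [← Finset.sum_filter_add_sum_filter_not (Finset.Icc 1 p) Odd
    (fun j => (-1 : ℝ) ^ (j + 1) * g j), sub_eq_add_neg, ← Finset.sum_neg_distrib]
  congr 1
  · refine Finset.sum_congr rfl fun j hj => ?_
    rw [(Finset.mem_filter.1 hj).2.add_one.neg_one_pow, one_mul]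
  · refine Finset.sum_congr rfl fun j hj => ?_
    rw [(Nat.not_odd_iff_even.1 (Finset.mem_filter.1 hj).2).add_one.neg_one_pow, neg_one_mul]

theorem exists_one_dim_kernel (p : ℕ) (hp : 2 ≤ p) :
    ∃ κ₀ : SignedMeasure ℝ,
      κ₀.totalVariation (Set.Ioo (0 : ℝ) 1)ᶜ = 0 ∧
      κ₀ (Set.Ioo (0 : ℝ) 1) = 1 ∧
      (∀ k : ℕ, 1 ≤ k → k ≤ p - 1 → sIntegral κ₀ (fun r => r ^ k) = 0) ∧
      tvNorm κ₀ ≤ (p : ℝ) * 2 ^ (3 * p - 1) := by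
  have hs : ∀ j ∈ (Finset.Icc 1 p).filter Odd, kerPt p j ∈ Set.Ioo (0 : ℝ) 1 :=
    fun j hj => kerPt_mem p j (Finset.mem_filter.1 hj).1
  have ht : ∀ j ∈ (Finset.Icc 1 p).filter (fun j => ¬ Odd j), kerPt p j ∈ Set.Ioo (0 : ℝ) 1 :=
    fun j hj => kerPt_mem p j (Finset.mem_filter.1 hj).1
  let J : JordanDecomposition ℝ :=
    { posPart := kerM p ((Finset.Icc 1 p).filter Odd)
      negPart := kerM p ((Finset.Icc 1 p).filter (fun j => ¬ Odd j))
      mutuallySingular := kerM_sing p _ _ (Finset.disjoint_filter_filter_not _ _ _) }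
  have hJ : J.toSignedMeasure.toJordanDecomposition = J :=
    JordanDecomposition.toJordanDecomposition_toSignedMeasure J
  refine ⟨J.toSignedMeasure, ?_, ?_, ?_, ?_⟩
  · rw [SignedMeasure.totalVariation, hJ, Measure.add_apply]
    rw [kerM_zero _ _ _ measurableSet_Ioo.compl (fun j hj h => h (hs j hj)),
      kerM_zero _ _ _ measurableSet_Ioo.compl (fun j hj h => h (ht j hj)), add_zero]
  · rw [JordanDecomposition.toSignedMeasure, Measure.toSignedMeasure_sub_apply measurableSet_Ioo,
      measureReal_def, measureReal_def, kerM_full _ _ _ measurableSet_Ioo hs,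
      kerM_full _ _ _ measurableSet_Ioo ht, ENNReal.toReal_natCast, ENNReal.toReal_natCast,
      Nat.cast_sum, Nat.cast_sum, ker_diff]
    simpa using ker_alt p 0 (by omega)
  · intro k hk hk'
    rw [sIntegral, hJ, kerM_int, kerM_int, ker_diff]
    have h := ker_alt p k (by omega)
    rw [zero_pow (by omega)] at h
    have h' := congrArg (fun z => z / ((p : ℝ) + 1) ^ k) h
    simp only [zero_div, Finset.sum_div] at h'
    rw [← h']
    refine Finset.sum_congr rfl fun j _ => ?_
    rw [kerPt, div_pow]; ring
  · rw [tvNorm, SignedMeasure.totalVariation, hJ, Measure.add_apply,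
      kerM_full _ _ _ MeasurableSet.univ (by simp), kerM_full _ _ _ MeasurableSet.univ (by simp),
      ← Nat.cast_add, ENNReal.toReal_natCast, Finset.sum_filter_add_sum_filter_not]
    have h1 : ∑ j ∈ Finset.Icc 1 p, p.choose j ≤ 2 ^ p := by
      rw [← Nat.sum_range_choose]
      refine Finset.sum_le_sum_of_subset fun j hj => ?_
      simp only [Finset.mem_Icc, Finset.mem_range] at *
      omega
    have h2 : 2 ^ p ≤ p * 2 ^ (3 * p - 1) :=
      (Nat.pow_le_pow_right (by norm_num) (by omega)).trans (Nat.le_mul_of_pos_left _ (by omega))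
    exact_mod_cast h1.trans h2
end
end

section
/- Let p ≥ 1 be an integer and let 0 < b_1 < b_2 < ⋯ < b_p be given by b_i = i/p. Let V be the p × p Vandermonde matrix with entries V_{kj} = b_j^{k−1} (1 ≤ k, j ≤ p). Then V is invertible and its inverse satisfies ‖V^{−1}‖ ≤ 2^{3p−1}, where ‖M‖ = max_{1 ≤ i ≤ p} Σ_{j=1}^p |m_{ij}| for a p × p matrix M = (m_{ij}). -/
open MeasureTheory
open scoped RealInnerProductSpace ENNReal NNReal

noncomputable section

open Polynomial in
lemma aux_coeff {ι : Type*} [DecidableEq ι] (s : Finset ι) (a b : ι → ℝ) :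
    ∀ N : ℕ, ∑ k ∈ Finset.range N, |(∏ m ∈ s, (C (a m) * (X - C (b m)))).coeff k|
      ≤ ∏ m ∈ s, (|a m| * (1 + |b m|)) := by
  induction s using Finset.induction_on with
  | empty =>
    intro N
    simp only [Finset.prod_empty, coeff_one]
    have : ∀ k : ℕ, |(if k = 0 then (1:ℝ) else 0)| = if k = 0 then 1 else 0 := by
      intro k; split_ifs <;> simp
    simp only [this]
    rw [Finset.sum_ite_eq']
    split_ifs <;> norm_num
  | insert x s hx ih =>
    intro N
    rw [Finset.prod_insert hx, Finset.prod_insert hx]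
    set q := ∏ m ∈ s, (C (a m) * (X - C (b m))) with hq
    set B := ∏ m ∈ s, (|a m| * (1 + |b m|)) with hB
    have h1 : ∀ N, ∑ k ∈ Finset.range N, |(X * q).coeff k| ≤ B := by
      intro N
      cases N with
      | zero => simpa using ih 0
      | succ n =>
        rw [Finset.sum_range_succ']
        simpa using ih n
    calc ∑ k ∈ Finset.range N, |(C (a x) * (X - C (b x)) * q).coeff k|
        ≤ ∑ k ∈ Finset.range N, (|a x| * |(X * q).coeff k| + |a x| * |b x| * |q.coeff k|) := by
          apply Finset.sum_le_sum
          intro k _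
          have : (C (a x) * (X - C (b x)) * q).coeff k
              = a x * (X * q).coeff k - a x * b x * q.coeff k := by
            rw [mul_assoc, coeff_C_mul, sub_mul, coeff_sub, coeff_C_mul]; ring
          rw [this, ← abs_mul, ← abs_mul, ← abs_mul]
          exact abs_sub _ _
      _ = |a x| * ∑ k ∈ Finset.range N, |(X * q).coeff k|
          + |a x| * |b x| * ∑ k ∈ Finset.range N, |q.coeff k| := by
          rw [Finset.sum_add_distrib, Finset.mul_sum, Finset.mul_sum]
      _ ≤ |a x| * B + |a x| * |b x| * B := by
          have := h1 N
          have := ih N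
          gcongr
      _ = _ := by ring

lemma aux_den (i d : ℕ) :
    ∏ m ∈ (Finset.range (i + 1 + d)).erase i, |(i : ℝ) - m| = (i.factorial : ℝ) * d.factorial := by
  induction d with
  | zero =>
    rw [Nat.add_zero, Finset.range_add_one, Finset.erase_insert (by simp)]
    simp only [Nat.factorial_zero, Nat.cast_one, mul_one]
    rw [← Finset.prod_range_add_one_eq_factorial, ← Finset.prod_range_reflect]
    push_cast
    apply Finset.prod_congr rfl
    intro m hm
    have hm := Finset.mem_range.1 hm
    have h : ((i - 1 - m : ℕ) : ℝ) = i - 1 - m := by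
      rw [Nat.sub_sub, Nat.cast_sub (by omega)]; push_cast; ring
    rw [h, abs_of_pos] <;> linarith [Nat.cast_nonneg (α := ℝ) m]
  | succ d ih =>
    rw [← Nat.add_assoc, Finset.range_add_one, Finset.erase_insert_of_ne (by omega),
      Finset.prod_insert (by simp), ih, Nat.factorial_succ]
    have : |(i : ℝ) - (i + 1 + d : ℕ)| = d + 1 := by
      push_cast
      rw [abs_of_neg] <;> linarith [Nat.cast_nonneg (α := ℝ) d]
    rw [this]; push_cast; ring

lemma aux_num (p n : ℕ) :
    (∏ m ∈ Finset.range n, ((p : ℝ) + m + 1)) = (p + n).choose n * n.factorial := by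
  induction n with
  | zero => simp
  | succ n ih =>
    rw [Finset.prod_range_succ, ih]
    have h := Nat.add_one_mul_choose_eq (p + n) n
    have h' : ((p + n + 1 : ℕ) : ℝ) * (p + n).choose n = (p + n + 1).choose (n + 1) * (n + 1 : ℕ) := by
      exact_mod_cast h
    rw [Nat.factorial_succ, ← Nat.add_assoc]
    push_cast at h' ⊢
    linear_combination (n.factorial : ℝ) * h'

lemma aux_prod (p i : ℕ) (hi : i < p) :
    ∏ m ∈ (Finset.range p).erase i,
      (|(((i : ℝ) + 1) / p - ((m : ℝ) + 1) / p)⁻¹| * (1 + |((m : ℝ) + 1) / p|)) ≤ 2 ^ (3 * p - 1) := by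
  have hp : (0 : ℝ) < p := by exact_mod_cast (by omega : 0 < p)
  have e : ∀ m ∈ (Finset.range p).erase i,
      (|(((i : ℝ) + 1) / p - ((m : ℝ) + 1) / p)⁻¹| * (1 + |((m : ℝ) + 1) / p|))
        = ((p : ℝ) + m + 1) / |(i : ℝ) - m| := by
    intro m hm
    have hne : (i : ℝ) - m ≠ 0 := by
      rw [sub_ne_zero]; exact_mod_cast (Finset.ne_of_mem_erase hm).symm
    have : ((i : ℝ) + 1) / p - ((m : ℝ) + 1) / p = (i - m) / p := by ring
    rw [this, abs_inv, abs_div, abs_of_pos hp, abs_of_nonneg (a := ((m : ℝ) + 1) / p) (by positivity)]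
    have := abs_pos.2 hne
    field_simp
    ring
  rw [Finset.prod_congr rfl e, Finset.prod_div_distrib]
  obtain ⟨d, rfl⟩ : ∃ d, p = i + 1 + d := ⟨p - (i + 1), by omega⟩
  rw [aux_den]
  have hn := aux_num (i + 1 + d) (i + 1 + d)
  rw [← Finset.mul_prod_erase _ _ (Finset.mem_range.2 hi)] at hn
  set N := ∏ m ∈ (Finset.range (i + 1 + d)).erase i, (((i + 1 + d : ℕ) : ℝ) + m + 1) with hN
  have hN0 : 0 ≤ N := Finset.prod_nonneg fun m _ => by positivity
  have hc : ((i + d).choose d : ℝ) * i.factorial * d.factorial = (i + d).factorial := by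
    exact_mod_cast Nat.add_choose_mul_factorial_mul_factorial i d
  have hf : ((i + 1 + d).factorial : ℝ) = ((i + 1 + d : ℕ) : ℝ) * (i + d).factorial := by
    rw [show i + 1 + d = (i + d) + 1 by ring, Nat.factorial_succ]; push_cast; ring
  have hb1 : ((i + 1 + d + (i + 1 + d)).choose (i + 1 + d) : ℝ) ≤ 2 ^ (i + 1 + d + (i + 1 + d)) := by
    exact_mod_cast Nat.choose_le_two_pow _ _
  have hb2 : ((i + d).choose d : ℝ) ≤ 2 ^ (i + d) := by
    exact_mod_cast Nat.choose_le_two_pow _ _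
  rw [div_le_iff₀ (by positivity),
    show 3 * (i + 1 + d) - 1 = (i + 1 + d + (i + 1 + d)) + (i + d) by omega, pow_add _ _ (i + d)]
  have h1 : ((i + 1 + d : ℕ) : ℝ) * N ≤ ((i + 1 + d : ℕ) : ℝ) *
      (2 ^ (i + 1 + d + (i + 1 + d)) * 2 ^ (i + d) * (i.factorial * d.factorial)) := by
    calc ((i + 1 + d : ℕ) : ℝ) * N ≤ (((i + 1 + d : ℕ) : ℝ) + i + 1) * N := by
          gcongr; linarith [Nat.cast_nonneg (α := ℝ) i]
      _ = ((i + 1 + d : ℕ) : ℝ) * (((i + 1 + d + (i + 1 + d)).choose (i + 1 + d) : ℝ) *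
            ((i + d).choose d : ℝ) * (i.factorial * d.factorial)) := by
          rw [hn, hf, ← hc]; ring
      _ ≤ _ := by gcongr
  exact le_of_mul_le_mul_left h1 hp

/-- **Bound on the inverse of a Vandermonde matrix** (from the proof of Lemma 3.2).
For `b_j = j/p` (`j = 1, …, p`), the Vandermonde matrix `V = (b_j^{k-1})` is invertible and
its inverse has maximum absolute row sum at most `2^{3p-1}`. -/
theorem vandermonde_inverse_norm_le (p : ℕ) (hp : 1 ≤ p)
    (V : Matrix (Fin p) (Fin p) ℝ)
    (hV : ∀ k j : Fin p, V k j = (((j : ℕ) + 1 : ℝ) / (p : ℝ)) ^ (k : ℕ)) :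
    IsUnit V.det ∧ ∀ i : Fin p, ∑ j, |V⁻¹ i j| ≤ 2 ^ (3 * p - 1) := by
  have hp0 : (p : ℝ) ≠ 0 := by exact_mod_cast (by omega : p ≠ 0)
  let b : ℕ → ℝ := fun m => ((m : ℝ) + 1) / p
  have hbinj : Function.Injective b := by
    intro x y h
    simp only [b] at h
    rw [div_left_inj' hp0] at h
    exact_mod_cast add_right_cancel h
  let W : Matrix (Fin p) (Fin p) ℝ := fun i k =>
    (Lagrange.basis (Finset.range p) b i).coeff k
  have hWV : W * V = 1 := by
    ext i j
    rw [Matrix.mul_apply]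
    have hdeg : (Lagrange.basis (Finset.range p) b i).natDegree < p := by
      rw [Lagrange.natDegree_basis hbinj.injOn (Finset.mem_range.2 i.2), Finset.card_range]
      omega
    have : ∑ k, W i k * V k j = (Lagrange.basis (Finset.range p) b i).eval (b j) := by
      rw [Polynomial.eval_eq_sum_range' hdeg, ← Fin.sum_univ_eq_sum_range
        (fun k => (Lagrange.basis (Finset.range p) b i).coeff k * b j ^ k)]
      exact Finset.sum_congr rfl fun k _ => by rw [hV]
    rw [this, Matrix.one_apply]
    split_ifs with h
    · subst h
      exact Lagrange.eval_basis_self hbinj.injOn (Finset.mem_range.2 i.2)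
    · exact Lagrange.eval_basis_of_ne (fun h' => h (Fin.ext h')) (Finset.mem_range.2 j.2)
  refine ⟨(Matrix.isUnit_iff_isUnit_det V).1 (IsUnit.of_mul_eq_one_right W hWV), fun i => ?_⟩
  rw [Matrix.inv_eq_left_inv hWV]
  simp only [W]
  rw [Fin.sum_univ_eq_sum_range (fun k => |(Lagrange.basis (Finset.range p) b i).coeff k|)]
  exact (aux_coeff ((Finset.range p).erase i) (fun m => (b i - b m)⁻¹) b p).trans
    (aux_prod p i i.2)
end
end

section
/- For every integer p ≥ 1 there exists a C^p-smooth function ψ : ℝ^d → [0,1] and an absolute constant c > 0 (independent of d and p) such that: ψ(x) = 1 for all |x| ≤ 1/2; ψ(x) = 0 for all |x| ≥ 1; and for every multi-index γ of length m with 0 ≤ m ≤ p, sup_{x ∈ ℝ^d} |D^γ ψ(x)| ≤ c^p · p^m. -/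
open MeasureTheory
open scoped RealInnerProductSpace ENNReal NNReal

noncomputable section


lemma radial_bound {E : Type*} [NormedAddCommGroup E] [InnerProductSpace ℝ E] (x : E)
    (hx : ‖x‖ ≤ 1) (A : ℝ) (hA : 0 ≤ A) (m : ℕ) : (m : ℝ) ≤ A → ∀ (f : ℝ → ℝ) (K : ℝ), 0 ≤ K →
      ContDiff ℝ m f → (∀ j ≤ m, |iteratedDeriv j f (‖x‖ ^ 2)| ≤ K * A ^ j) →
      ‖iteratedFDeriv ℝ m (fun y : E => f (‖y‖ ^ 2)) x‖ ≤ K * (3 * A) ^ m := by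
  induction m using Nat.strong_induction_on with
  | _ m ih =>
  intro hm f K hK hf hb
  rcases m with _ | m
  · have := hb 0 le_rfl
    simpa using this
  have hm' : (m : ℝ) + 1 ≤ A := by exact_mod_cast hm
  have hdiff : Differentiable ℝ f := hf.differentiable (by simp)
  have hf' : ContDiff ℝ m (deriv f) := by
    have h : ContDiff ℝ ((m : WithTop ℕ∞) + 1) f := by exact_mod_cast hf
    exact (contDiff_succ_iff_deriv.1 h).2.2
  have hb' : ∀ j ≤ m, |iteratedDeriv j (deriv f) (‖x‖ ^ 2)| ≤ (K * A) * A ^ j := by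
    intro j hj
    have := hb (j + 1) (by omega)
    rw [iteratedDeriv_succ'] at this
    calc _ ≤ _ := this
      _ = _ := by ring
  have hfd : fderiv ℝ (fun y : E => f (‖y‖ ^ 2)) =
      fun y => deriv f (‖y‖ ^ 2) • ((2 : ℝ) • innerSL ℝ) y := by
    funext y
    have h1 : HasFDerivAt (fun y : E => ‖y‖ ^ 2) (2 • innerSL ℝ y) y :=
      (hasStrictFDerivAt_norm_sq y).hasFDerivAt
    have h2 := (hdiff (‖y‖ ^ 2)).hasDerivAt.comp_hasFDerivAt y h1
    have h3 := h2.fderiv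
    rw [Function.comp_def] at h3
    rw [h3]
    ext z
    simp
  have hns : ContDiff ℝ m (fun y : E => ‖y‖ ^ 2) := contDiff_norm_sq ℝ
  set L : E →L[ℝ] E →L[ℝ] ℝ := (2 : ℝ) • innerSL ℝ with hL
  have hLn : ‖L‖ ≤ 2 := by
    refine L.opNorm_le_bound (by norm_num) fun y => ?_
    have : L y = (2 : ℝ) • innerSL ℝ y := rfl
    rw [this, norm_smul, innerSL_apply_norm]
    simp
  have hL0 : ‖iteratedFDeriv ℝ 0 (fun y => L y) x‖ ≤ 2 := by
    rw [norm_iteratedFDeriv_zero]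
    refine (L.le_opNorm x).trans ?_
    nlinarith [norm_nonneg x, norm_nonneg L]
  have hL1 : ‖iteratedFDeriv ℝ 1 (fun y => L y) x‖ ≤ 2 := by
    rw [norm_iteratedFDeriv_one]
    rwa [L.fderiv]
  have hL2 : ∀ i, ‖iteratedFDeriv ℝ (i + 2) (fun y => L y) x‖ = 0 := by
    intro i
    have : fderiv ℝ (fun y => L y) = fun _ => L := by
      funext y
      exact L.fderiv
    rw [← norm_iteratedFDeriv_fderiv, this, iteratedFDeriv_succ_const]
    simp
  rw [← norm_iteratedFDeriv_fderiv, hfd]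
  have hcomp : ContDiff ℝ m (fun y : E => deriv f (‖y‖ ^ 2)) := hf'.comp hns
  have hLc : ContDiff ℝ m (fun y : E => L y) := L.contDiff
  refine (norm_iteratedFDeriv_smul_le hcomp hLc x le_rfl).trans ?_
  rw [← Finset.sum_range_reflect]
  have hT : ∀ n ≤ m, ‖iteratedFDeriv ℝ n (fun y : E => deriv f (‖y‖ ^ 2)) x‖
      ≤ (K * A) * (3 * A) ^ n := by
    intro n hn
    refine ih n (by omega) ?_ (deriv f) (K * A) (by positivity) (hf'.of_le (by exact_mod_cast hn))
      (fun j hj => hb' j (by omega))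
    have : (n : ℝ) ≤ m := by exact_mod_cast hn
    linarith
  rcases m with _ | m
  · have := hT 0 le_rfl
    simp only [zero_add, Finset.sum_range_one, Nat.sub_self, Nat.choose_self, Nat.cast_one, one_mul, Nat.sub_zero, Nat.add_sub_cancel]
    calc _ ≤ (K * A) * (3 * A) ^ 0 * 2 := by gcongr
      _ ≤ _ := by nlinarith [mul_nonneg hK hA]
  rw [Finset.sum_range_succ', Finset.sum_range_succ', Finset.sum_eq_zero]
  · have h1 := hT (m + 1) le_rfl
    have h2 := hT m (by omega)
    have e1 : m + 1 + 1 - 1 - (0 + 1) = m := by omega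
    have e2 : m + 1 + 1 - 1 - 0 = m + 1 := by omega
    have e3 : m + 1 - m = 1 := by omega
    rw [e1, e2, e3, Nat.sub_self, Nat.choose_self, Nat.choose_succ_self_right, zero_add]
    push_cast at hm' ⊢
    calc _ ≤ ((m : ℝ) + 1) * (K * A * (3 * A) ^ m) * 2 + 1 * (K * A * (3 * A) ^ (m + 1)) * 2 := by
          gcongr
      _ ≤ A * (K * A * (3 * A) ^ m) * 2 + 1 * (K * A * (3 * A) ^ (m + 1)) * 2 := by
          gcongr
          linarith
      _ = (8 / 9) * (K * (3 * A) ^ (m + 2)) := by ring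
      _ ≤ _ := by
          have : 0 ≤ K * (3 * A) ^ (m + 2) := by positivity
          linarith
  · intro i hi
    have hi' := Finset.mem_range.1 hi
    have e : m + 1 - (m + 1 + 1 - 1 - (i + 1 + 1)) = i + 2 := by omega
    rw [e, hL2, mul_zero]

/-- iterated averages -/
def avgIter (h : ℝ) : ℕ → ℝ → ℝ
  | 0 => fun t => max 0 (min 1 (2 - 2 * t))
  | n + 1 => fun t => h⁻¹ * ∫ s in t..(t + h), avgIter h n s

lemma avgIter_cont (h : ℝ) (n : ℕ) : ContDiff ℝ n (avgIter h n) ∧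
    ∀ t, HasDerivAt (avgIter h (n + 1)) (h⁻¹ * (avgIter h n (t + h) - avgIter h n t)) t := by
  have key : ∀ n, Continuous (avgIter h n) →
    ∀ t, HasDerivAt (avgIter h (n + 1)) (h⁻¹ * (avgIter h n (t + h) - avgIter h n t)) t := by
    intro n hc t
    have hG : ∀ u, HasDerivAt (fun u => ∫ s in (0 : ℝ)..u, avgIter h n s) (avgIter h n u) u :=
      fun u => intervalIntegral.integral_hasDerivAt_right (hc.intervalIntegrable _ _)
        hc.stronglyMeasurable.stronglyMeasurableAtFilter hc.continuousAt
    have h1 := ((hG (t + h)).comp_add_const t h).sub (hG t)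
    have h2 := h1.const_mul h⁻¹
    refine h2.congr_of_eventuallyEq (Filter.Eventually.of_forall fun u => ?_)
    simp only [avgIter, Pi.sub_apply]
    rw [intervalIntegral.integral_interval_sub_left] <;> exact hc.intervalIntegrable _ _
  have h0 : ContDiff ℝ n (avgIter h n) := by
    induction n with
    | zero =>
      rw [Nat.cast_zero, contDiff_zero]
      simp only [avgIter]
      fun_prop
    | succ n ih =>
      have hk := key n ih.continuous
      push_cast
      rw [contDiff_succ_iff_deriv]
      refine ⟨fun t => (hk t).differentiableAt, by simp, ?_⟩
      rw [funext fun t => (hk t).deriv]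
      exact contDiff_const.mul ((ih.comp (contDiff_id.add contDiff_const)).sub ih)
  exact ⟨h0, key n h0.continuous⟩

lemma avgIter_Icc (h : ℝ) (hh : 0 < h) (n : ℕ) : ∀ t, avgIter h n t ∈ Set.Icc (0 : ℝ) 1 := by
  induction n with
  | zero => intro t; simp [avgIter]
  | succ n ih =>
    intro t
    have hc := (avgIter_cont h n).1.continuous
    simp only [avgIter]
    constructor
    · have := intervalIntegral.integral_nonneg (μ := volume) (a := t) (b := t + h) (by linarith)
        (fun u _ => (ih u).1)
      positivity
    · have := intervalIntegral.integral_mono_on (μ := volume) (a := t) (b := t + h) (by linarith)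
        (hc.intervalIntegrable _ _) (continuous_const.intervalIntegrable _ _)
        (fun u _ => (ih u).2)
      simp only [intervalIntegral.integral_const, add_sub_cancel_left, smul_eq_mul, mul_one] at this
      rw [inv_mul_le_iff₀ hh]
      linarith

lemma avgIter_one (h : ℝ) (hh : 0 < h) (n : ℕ) : ∀ t, t + n * h ≤ 1 / 2 → avgIter h n t = 1 := by
  induction n with
  | zero =>
    intro t ht
    simp only [avgIter]
    simp only [Nat.cast_zero, zero_mul, add_zero] at ht
    rw [min_eq_left (by linarith)]
    simp
  | succ n ih =>
    intro t ht
    push_cast at ht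
    simp only [avgIter]
    rw [intervalIntegral.integral_congr (g := fun _ => (1 : ℝ))]
    · simp [hh.ne']
    · intro u hu
      rw [Set.uIcc_of_le (by linarith)] at hu
      exact ih u (by linarith [hu.2])

lemma avgIter_zero (h : ℝ) (hh : 0 < h) (n : ℕ) : ∀ t, 1 ≤ t → avgIter h n t = 0 := by
  induction n with
  | zero =>
    intro t ht
    simp only [avgIter]
    exact max_eq_left ((min_le_right _ _).trans (by linarith))
  | succ n ih =>
    intro t ht
    simp only [avgIter]
    rw [intervalIntegral.integral_congr (g := fun _ => (0 : ℝ))]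
    · simp
    · intro u hu
      rw [Set.uIcc_of_le (by linarith)] at hu
      exact ih u (by linarith [hu.1])

lemma avgIter_bound (h : ℝ) (hh : 0 < h) (n : ℕ) : ∀ k ≤ n, ∀ t,
    |iteratedDeriv k (avgIter h n) t| ≤ (2 * h⁻¹) ^ k := by
  have h0 : ∀ n t, |iteratedDeriv 0 (avgIter h n) t| ≤ (2 * h⁻¹) ^ 0 := by
    intro n t
    have := avgIter_Icc h hh n t
    simp only [iteratedDeriv_zero, pow_zero]
    rw [abs_of_nonneg this.1]
    exact this.2
  induction n with
  | zero =>
    intro k hk t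
    obtain rfl : k = 0 := by omega
    exact h0 _ t
  | succ n ih =>
    intro k hk t
    rcases k with _ | k
    · exact h0 _ t
    have hc : ContDiff ℝ k (avgIter h n) :=
      (avgIter_cont h n).1.of_le (by exact_mod_cast (by omega : k ≤ n))
    have hc' : ContDiff ℝ k (fun t => avgIter h n (t + h)) :=
      hc.comp (contDiff_id.add contDiff_const)
    rw [iteratedDeriv_succ', funext fun t => ((avgIter_cont h n).2 t).deriv,
      iteratedDeriv_const_mul_field, iteratedDeriv_fun_sub hc'.contDiffAt hc.contDiffAt,
      iteratedDeriv_comp_add_const]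
    have a := ih k (by omega) t
    have b := ih k (by omega) (t + h)
    rw [abs_mul, abs_of_pos (inv_pos.2 hh)]
    calc _ ≤ h⁻¹ * ((2 * h⁻¹) ^ k + (2 * h⁻¹) ^ k) := by
          gcongr
          exact (abs_sub _ _).trans (add_le_add b a)
      _ = _ := by ring

lemma multiIndexDirs_length {d : ℕ} (α : Fin d → ℕ) :
    (multiIndexDirs α).length = ∑ i, α i := by
  simp [multiIndexDirs, List.length_flatMap, Fin.sum_univ_def]

lemma abs_mderiv_le {d : ℕ} (α : Fin d → ℕ) (u : EuclideanSpace ℝ (Fin d) → ℝ)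
    (x : EuclideanSpace ℝ (Fin d)) :
    |mderiv α u x| ≤ ‖iteratedFDeriv ℝ (∑ i, α i) u x‖ := by
  rw [← multiIndexDirs_length]
  have := (iteratedFDeriv ℝ (multiIndexDirs α).length u x).le_opNorm
    (fun k => EuclideanSpace.single ((multiIndexDirs α).get k) (1 : ℝ))
  simpa [mderiv] using this

/-- **Lemma 4.1.** There is an absolute constant `c > 0` (independent of `d` and `p`) such
that for every `p ≥ 1` and every dimension `d` there exists a `C^p`-smooth function
`ψ : ℝ^d → [0,1]` with `ψ = 1` on `{|x| ≤ 1/2}`, `ψ = 0` on `{|x| ≥ 1}`, and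
`sup_x |D^γ ψ(x)| ≤ c^p p^m` for every multi-index `γ` of length `m ≤ p`. -/
theorem exists_cutoff_function :
    ∃ c : ℝ, 0 < c ∧ ∀ (d p : ℕ), 1 ≤ p →
    ∃ ψ : EuclideanSpace ℝ (Fin d) → ℝ, ContDiff ℝ (p : ℕ∞) ψ ∧
      (∀ x, ψ x ∈ Set.Icc (0 : ℝ) 1) ∧
      (∀ x : EuclideanSpace ℝ (Fin d), ‖x‖ ≤ 1 / 2 → ψ x = 1) ∧
      (∀ x : EuclideanSpace ℝ (Fin d), 1 ≤ ‖x‖ → ψ x = 0) ∧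
      (∀ γ : Fin d → ℕ, (∑ i, γ i) ≤ p → ∀ x,
        |mderiv γ ψ x| ≤ c ^ p * (p : ℝ) ^ (∑ i, γ i)) := by
  refine ⟨24, by norm_num, fun d p hp => ?_⟩
  have hp1 : (1 : ℝ) ≤ p := by exact_mod_cast hp
  have hp0 : (0 : ℝ) < p := by linarith
  set h : ℝ := 1 / (4 * p) with hdef
  have hh : 0 < h := by positivity
  have hinv : 2 * h⁻¹ = 8 * p := by
    rw [hdef]
    field_simp
    norm_num
  have hcd := (avgIter_cont h p).1
  refine ⟨fun x => avgIter h p (‖x‖ ^ 2), ?_, fun x => avgIter_Icc h hh p _, ?_, ?_, ?_⟩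
  · exact ContDiff.comp (g := avgIter h p) (by exact_mod_cast hcd) (contDiff_norm_sq ℝ)
  · intro x hx
    apply avgIter_one h hh
    have : (p : ℝ) * h = 1 / 4 := by
      rw [hdef]
      field_simp
    rw [this]
    nlinarith [norm_nonneg x]
  · intro x hx
    apply avgIter_zero h hh
    nlinarith
  · intro γ hγ x
    refine (abs_mderiv_le γ _ x).trans ?_
    set m := ∑ i, γ i with hm
    have hmp : (m : ℝ) ≤ p := by exact_mod_cast hγ
    rcases le_or_gt ‖x‖ 1 with hx | hx
    · have := radial_bound x hx (8 * p) (by positivity) m (by linarith) (avgIter h p) 1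
        (by norm_num) (hcd.of_le (by exact_mod_cast hγ)) (fun j hj => by
          rw [one_mul, ← hinv]
          exact avgIter_bound h hh p j (by omega) _)
      refine this.trans ?_
      calc 1 * (3 * (8 * (p : ℝ))) ^ m = 24 ^ m * (p : ℝ) ^ m := by rw [← mul_pow]; ring
        _ ≤ 24 ^ p * (p : ℝ) ^ m := by
          gcongr
          norm_num
    · have hev : (fun y : EuclideanSpace ℝ (Fin d) => avgIter h p (‖y‖ ^ 2)) =ᶠ[nhds x]
          fun _ => 0 := by
        filter_upwards [(continuous_norm.tendsto x).eventually (lt_mem_nhds hx)] with y hy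
        apply avgIter_zero h hh
        nlinarith
      rw [(hev.iteratedFDeriv ℝ m).eq_of_nhds]
      have hz : iteratedFDeriv ℝ m (fun _ : EuclideanSpace ℝ (Fin d) => (0 : ℝ)) x = 0 := by
        simp
      rw [hz, norm_zero]
      positivity
end
end
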